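/- arXiv:1710.06535 — 3 statements merged into one kernel-verified Lean document; each statement's English description precedes it below -/
import Mathlib

section
/- Let G be a connected graph on n vertices with chromatic number exactly 4. If Q_G(y) = (y+1)·y^{n-3}·(y-1)·(y-2) holds for some integer y ≥ 3, then G can be obtained from the complete graph K_4 by repeatedly adding pendant vertices (vertices of degree 1); conversely, every graph obtained from K_4 in this way satisfies Q_G(y) = (y+1)·y^{n-3}·(y-1)·(y-2) for every real y. -/
/-- The number of proper colourings of `G` with `x` (labelled) colours. -/
noncomputable def numColorings {V : Type} (G : SimpleGraph V) (x : ℕ) : ℕ :=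
  Nat.card {f : V → Fin x // ∀ u v : V, G.Adj u v → f u ≠ f v}

/-- `G` is obtained from the complete graph `K_k` by repeatedly adding pendant vertices:
there is an ordering of the vertices (via an isomorphism with a graph on `Fin n`) in which
the first `k` vertices form a clique and every later vertex is joined by an edge to
exactly one earlier vertex. -/
def ObtainedFromCliqueByPendants {V : Type} (G : SimpleGraph V) (k : ℕ) : Prop :=
  ∃ (n : ℕ) (p : ℕ → ℕ), k ≤ n ∧ (∀ i : ℕ, k ≤ i → i < n → p i < i) ∧
    Nonempty (G ≃g SimpleGraph.fromRel (fun a b : Fin n =>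
      (a.val < k ∧ b.val < k ∧ a ≠ b) ∨ (k ≤ a.val ∧ p a.val = b.val)))

section Counting

/-- Proper colourings of `G` with `q` colours. -/
abbrev ProperColoring {V : Type} (G : SimpleGraph V) (q : ℕ) : Type :=
  {f : V → Fin q // ∀ u v : V, G.Adj u v → f u ≠ f v}

open scoped Classical in
/-- Colourings of `G` correspond to a colouring of `G - w` with a colour for `w` missing from its
neighbourhood. -/
noncomputable def coloringEquivSigma {V : Type} [Fintype V] (G : SimpleGraph V) (w : V) (q : ℕ) :
    ProperColoring G q ≃ Σ c : ProperColoring (G.induce ({w}ᶜ : Set V)) q,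
        {i : Fin q // i ∉ (Finset.univ.filter fun x : ({w}ᶜ : Set V) => G.Adj w x).image c.1} where
  toFun f := ⟨⟨fun x => f.1 x, fun u v h => f.2 _ _ h⟩, ⟨f.1 w, by
    simp only [Finset.mem_image, Finset.mem_filter, Finset.mem_univ, true_and, not_exists, not_and]
    intro x hx
    exact f.2 _ _ hx.symm⟩⟩
  invFun p := ⟨fun x => if h : x = w then p.2.1 else p.1.1 ⟨x, h⟩, by
    intro u v huv
    have key : ∀ (x : V) (hx : x ≠ w), G.Adj w x → p.2.1 ≠ p.1.1 ⟨x, hx⟩ := by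
      intro x hx hwx heq
      apply p.2.2
      simp only [Finset.mem_image, Finset.mem_filter, Finset.mem_univ, true_and]
      exact ⟨⟨x, hx⟩, hwx, heq.symm⟩
    by_cases hu : u = w <;> by_cases hv : v = w
    · subst hu; subst hv; exact absurd huv (G.loopless.irrefl _)
    · subst hu; simpa [hv] using key v hv huv
    · subst hv; simpa [hu] using (key u hu huv.symm).symm
    · simpa [hu, hv] using p.1.2 ⟨u, hu⟩ ⟨v, hv⟩ huv⟩
  left_inv f := by
    ext x
    by_cases h : x = w
    · subst h; simp
    · simp [h]
  right_inv p := by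
    rcases p with ⟨⟨c, hc⟩, ⟨i, hi⟩⟩
    have h1 : (fun x : ({w}ᶜ : Set V) => if h : (x : V) = w then i else c ⟨x, h⟩) = c := by
      funext x
      have : (x : V) ≠ w := x.2
      simp [this]
    refine Sigma.ext (Subtype.ext h1) ?_
    simp only [dite_true]
    rw [Subtype.heq_iff_coe_eq]
    intro j
    simp only [h1]

open scoped Classical in
theorem numColorings_eq_sum {V : Type} [Fintype V] (G : SimpleGraph V) (w : V) (q : ℕ)
    [Fintype (ProperColoring (G.induce ({w}ᶜ : Set V)) q)] :
    numColorings G q =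
      ∑ c : ProperColoring (G.induce ({w}ᶜ : Set V)) q,
        (q - ((Finset.univ.filter fun x : ({w}ᶜ : Set V) => G.Adj w x).image c.1).card) := by
  rw [numColorings, Nat.card_congr (coloringEquivSigma G w q), Nat.card_sigma]
  refine Finset.sum_congr rfl fun c _ => ?_
  rw [Nat.card_eq_fintype_card, Fintype.card_subtype_compl]
  rw [Fintype.card_fin, Fintype.card_coe]

theorem numColorings_congr {V W : Type} {G : SimpleGraph V} {H : SimpleGraph W} (e : G ≃g H)
    (q : ℕ) : numColorings G q = numColorings H q := by
  refine Nat.card_congr ((Equiv.arrowCongr e.toEquiv (Equiv.refl _)).subtypeEquiv fun f => ?_)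
  constructor
  · intro h u v huv
    exact h (e.symm u) (e.symm v) (e.symm.map_adj_iff.2 huv)
  · intro h u v huv
    have h' := h (e u) (e v) (e.map_adj_iff.2 huv)
    change f (e.symm (e u)) ≠ f (e.symm (e v)) at h'
    simpa only [RelIso.symm_apply_apply] using h'

/-- Number of proper colourings satisfying an extra condition. -/
noncomputable def numColoringsWith {V : Type} (G : SimpleGraph V) (q : ℕ)
    (R : (V → Fin q) → Prop) : ℕ :=
  Nat.card {c : ProperColoring G q // R c.1}

open scoped Classical in
theorem numColoringsWith_eq_sum {V : Type} (G : SimpleGraph V) (q : ℕ)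
    [Fintype (ProperColoring G q)] (R : (V → Fin q) → Prop) :
    numColoringsWith G q R = ∑ c : ProperColoring G q, if R c.1 then 1 else 0 := by
  rw [numColoringsWith, Nat.card_eq_fintype_card, Fintype.card_subtype, Finset.card_filter]

/-- Colourings constant along the fibres of `g` are colourings of the quotient graph. -/
theorem numColoringsWith_le_of_quotient {V : Type} [Finite V] {G : SimpleGraph V}
    (hG : G.Connected) (q k : ℕ) {K : ℝ} (hK0 : 0 ≤ K) (g : V → V) (hk : (Set.range g).ncard ≤ k)
    (R : (V → Fin q) → Prop) (hR : ∀ c, R c → ∀ x y, g x = g y → c x = c y)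
    (hK : ∀ (W : Type) [Finite W] (H : SimpleGraph W), Nat.card W ≤ k → H.Connected →
      ∀ φ : G →g H, (∀ x y, g x = g y → φ x = φ y) → (numColorings H q : ℝ) ≤ K) :
    (numColoringsWith G q R : ℝ) ≤ K := by
  by_cases hadj : ∃ x y, G.Adj x y ∧ g x = g y
  · obtain ⟨x, y, hxy, hg⟩ := hadj
    have : IsEmpty {c : ProperColoring G q // R c.1} :=
      ⟨fun c => c.1.2 x y hxy (hR _ c.2 x y hg)⟩
    rw [numColoringsWith, Nat.card_of_isEmpty]
    exact_mod_cast hK0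
  · push Not at hadj
    let H : SimpleGraph (Set.range g) :=
      { Adj := fun p r => ∃ x y, g x = p ∧ g y = r ∧ G.Adj x y
        symm := ⟨fun p r ⟨x, y, hx, hy, h⟩ => ⟨y, x, hy, hx, h.symm⟩⟩
        loopless := ⟨fun p ⟨x, y, hx, hy, h⟩ => hadj x y h (hx.trans hy.symm)⟩ }
    let φ : G →g H := ⟨Set.rangeFactorization g, fun {x y} h => ⟨x, y, rfl, rfl, h⟩⟩
    have hφ : Function.Surjective φ := Set.rangeFactorization_surjective
    have hHc : H.Connected := by
      have := hG.nonempty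
      have : Nonempty (Set.range g) := ⟨φ (Classical.arbitrary V)⟩
      exact ⟨hG.preconnected.map φ hφ⟩
    refine le_trans (Nat.cast_le.2 ?_)
      (hK _ H (by rwa [Nat.card_coe_set_eq]) hHc φ fun x y h => Subtype.ext h)
    rw [numColoringsWith, numColorings]
    let s := Function.surjInv hφ
    have hs : ∀ p, φ (s p) = p := Function.surjInv_eq hφ
    have hgs : ∀ x, g (s (φ x)) = g x := fun x => congrArg Subtype.val (hs (φ x))
    refine Nat.card_le_card_of_injective
      (fun c => ⟨fun p => c.1.1 (s p), ?_⟩) ?_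
    · rintro p r ⟨x, y, hx, hy, h⟩
      have hx' : c.1.1 (s p) = c.1.1 x := hR _ c.2 _ _ ((congrArg Subtype.val (hs p)).trans hx.symm)
      have hy' : c.1.1 (s r) = c.1.1 y := hR _ c.2 _ _ ((congrArg Subtype.val (hs r)).trans hy.symm)
      change c.1.1 (s p) ≠ c.1.1 (s r)
      rw [hx', hy']
      exact c.1.2 x y h
    · intro c c' h
      apply Subtype.ext
      apply Subtype.ext
      funext x
      have h1 := congrFun (congrArg Subtype.val h) (φ x)
      simp only at h1
      rw [hR _ c.2 _ _ (hgs x), hR _ c'.2 _ _ (hgs x)] at h1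
      exact h1

end Counting

section Deletion

theorem numColorings_eq_card_univ {V : Type} (G : SimpleGraph V) (q : ℕ)
    [Fintype (ProperColoring G q)] : numColorings G q = ∑ _c : ProperColoring G q, 1 := by
  rw [numColorings, Nat.card_eq_fintype_card]
  simp

theorem numColorings_le_of_adj {V : Type} [Finite V] {G : SimpleGraph V} {w x : V}
    (h : G.Adj w x) (q : ℕ) :
    numColorings G q ≤ (q - 1) * numColorings (G.induce ({w}ᶜ : Set V)) q := by
  classical
  have := Fintype.ofFinite V
  have := Fintype.ofFinite (ProperColoring (G.induce ({w}ᶜ : Set V)) q)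
  rw [numColorings_eq_sum G w, numColorings_eq_card_univ (G.induce ({w}ᶜ : Set V)),
    Finset.mul_sum]
  refine Finset.sum_le_sum fun c _ => ?_
  rw [mul_one]
  refine Nat.sub_le_sub_left (Finset.card_pos.2 ⟨c.1 ⟨x, h.ne'⟩, ?_⟩) q
  exact Finset.mem_image_of_mem _ (by simpa using h)

theorem numColorings_of_unique_adj {V : Type} [Finite V] {G : SimpleGraph V} {w x : V}
    (h : ∀ y, G.Adj w y ↔ y = x) (q : ℕ) :
    numColorings G q = (q - 1) * numColorings (G.induce ({w}ᶜ : Set V)) q := by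
  classical
  have := Fintype.ofFinite V
  have := Fintype.ofFinite (ProperColoring (G.induce ({w}ᶜ : Set V)) q)
  rw [numColorings_eq_sum G w, numColorings_eq_card_univ (G.induce ({w}ᶜ : Set V)),
    Finset.mul_sum]
  refine Finset.sum_congr rfl fun c _ => ?_
  have hx : (Finset.univ.filter fun y : ({w}ᶜ : Set V) => G.Adj w y) =
      {⟨x, ((h x).2 rfl).ne'⟩} := by
    ext y
    simp [h, Subtype.ext_iff]
  rw [mul_one, hx, Finset.image_singleton, Finset.card_singleton]

theorem numColorings_le_of_adj_of_adj {V : Type} [Finite V] {G : SimpleGraph V} {w : V}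
    {a b : ({w}ᶜ : Set V)} (ha : G.Adj w a) (hb : G.Adj w b) {q : ℕ} (hq : 2 ≤ q) :
    numColorings G q ≤ (q - 2) * numColorings (G.induce ({w}ᶜ : Set V)) q +
      numColoringsWith (G.induce ({w}ᶜ : Set V)) q (fun c => c a = c b) := by
  classical
  have := Fintype.ofFinite V
  have := Fintype.ofFinite (ProperColoring (G.induce ({w}ᶜ : Set V)) q)
  rw [numColorings_eq_sum G w, numColorings_eq_card_univ (G.induce ({w}ᶜ : Set V)),
    Finset.mul_sum, numColoringsWith_eq_sum, ← Finset.sum_add_distrib]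
  refine Finset.sum_le_sum fun c _ => ?_
  have ha' : c.1 a ∈ (Finset.univ.filter fun x : ({w}ᶜ : Set V) => G.Adj w x).image c.1 :=
    Finset.mem_image_of_mem _ (by simpa using ha)
  have hb' : c.1 b ∈ (Finset.univ.filter fun x : ({w}ᶜ : Set V) => G.Adj w x).image c.1 :=
    Finset.mem_image_of_mem _ (by simpa using hb)
  split_ifs with hab
  · have := Finset.card_pos.2 ⟨_, ha'⟩
    omega
  · have := Finset.one_lt_card.2 ⟨_, ha', _, hb', hab⟩
    omega

/-- The colours on `S` split it into the class `A ∪ {a}` and the class of the remaining vertices. -/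
def SplitsAs {U : Type} (q : ℕ) (S : Finset U) (a : U) (A : Finset U) (c : U → Fin q) : Prop :=
  (∀ x ∈ A, c x = c a) ∧ ∀ x ∈ S, ∀ y ∈ S, x ≠ a → y ≠ a → x ∉ A → y ∉ A → c x = c y

open scoped Classical in
theorem numColorings_add_le_of_three_le_card {V : Type} [Finite V] {G : SimpleGraph V} {w : V}
    {S : Finset ({w}ᶜ : Set V)} (hS : ∀ x ∈ S, G.Adj w x) {a : ({w}ᶜ : Set V)} (ha : a ∈ S)
    (hcard : 3 ≤ S.card) {q : ℕ} (hq : 3 ≤ q) :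
    numColorings G q +
        numColoringsWith (G.induce ({w}ᶜ : Set V)) q (fun c => ∀ x ∈ S, c x = c a) ≤
      (q - 3) * numColorings (G.induce ({w}ᶜ : Set V)) q +
        ∑ A ∈ (S.erase a).ssubsets,
          numColoringsWith (G.induce ({w}ᶜ : Set V)) q (SplitsAs q S a A) := by
  have := Fintype.ofFinite V
  have := Fintype.ofFinite (ProperColoring (G.induce ({w}ᶜ : Set V)) q)
  rw [numColorings_eq_sum G w, numColorings_eq_card_univ (G.induce ({w}ᶜ : Set V)),
    Finset.mul_sum, numColoringsWith_eq_sum, ← Finset.sum_add_distrib]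
  simp only [numColoringsWith_eq_sum]
  rw [Finset.sum_comm, ← Finset.sum_add_distrib]
  refine Finset.sum_le_sum fun c _ => ?_
  set I := (Finset.univ.filter fun x : ({w}ᶜ : Set V) => G.Adj w x).image c.1 with hI
  have hmem : ∀ x ∈ S, c.1 x ∈ I := fun x hx =>
    Finset.mem_image_of_mem _ (by simpa using hS x hx)
  have hpos := Finset.card_pos.2 ⟨_, hmem a ha⟩
  rw [← Finset.card_filter]
  split_ifs with hmono
  · have hall : ((S.erase a).ssubsets.filter fun A => SplitsAs q S a A c.1) =
        (S.erase a).ssubsets := by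
      refine Finset.filter_true_of_mem fun A hA => ⟨fun x hx => ?_, fun x hx y hy _ _ _ _ => ?_⟩
      · exact hmono x (Finset.mem_of_mem_erase ((Finset.mem_ssubsets.1 hA).1 hx))
      · rw [hmono x hx, hmono y hy]
    have h3 : 3 ≤ (S.erase a).ssubsets.card := by
      rw [Finset.ssubsets, Finset.card_erase_of_mem (Finset.mem_powerset_self _),
        Finset.card_powerset, Finset.card_erase_of_mem ha]
      have : 2 ^ 2 ≤ 2 ^ (S.card - 1) := Nat.pow_le_pow_right (by norm_num) (by omega)
      omega
    rw [hall]
    omega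
  · push Not at hmono
    obtain ⟨b, hb, hba⟩ := hmono
    by_cases h3 : ∃ d ∈ S, c.1 d ≠ c.1 a ∧ c.1 d ≠ c.1 b
    · obtain ⟨d, hd, hda, hdb⟩ := h3
      have := Finset.two_lt_card.2 ⟨_, hmem a ha, _, hmem b hb, _, hmem d hd, hba.symm,
        hda.symm, hdb.symm⟩
      omega
    · push Not at h3
      have h2 := Finset.one_lt_card.2 ⟨_, hmem a ha, _, hmem b hb, hba.symm⟩
      have h1 : 0 < ((S.erase a).ssubsets.filter fun A => SplitsAs q S a A c.1).card := by
        refine Finset.card_pos.2 ⟨(S.erase a).filter fun x => c.1 x = c.1 a, ?_⟩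
        rw [Finset.mem_filter, Finset.mem_ssubsets]
        refine ⟨?_, fun x hx => (Finset.mem_filter.1 hx).2, fun x hx y hy hxa hya hxA hyA => ?_⟩
        · rw [Finset.filter_ssubset]
          exact ⟨b, Finset.mem_erase.2 ⟨fun h => hba (by rw [h]), hb⟩, hba⟩
        · simp only [Finset.mem_filter, Finset.mem_erase, not_and] at hxA hyA
          rw [h3 x hx (hxA ⟨hxa, hx⟩), h3 y hy (hyA ⟨hya, hy⟩)]
      omega

end Deletion

section Steps

theorem ncard_range_le_of_notMem {U : Type} [Finite U] (g : U → U) (T : Finset U)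
    (h : ∀ x, g x ∉ T) : (Set.range g).ncard ≤ Nat.card U - T.card := by
  have h1 : Set.range g ⊆ ((T : Set U))ᶜ := by
    rintro _ ⟨x, rfl⟩
    exact h x
  have h2 := Set.ncard_le_ncard h1
  rwa [Set.ncard_compl, Set.ncard_coe_finset] at h2

theorem numColoringsWith_pair_le {U : Type} [Finite U] {H : SimpleGraph U} (hH : H.Connected)
    {a b : U} (hab : a ≠ b) (q : ℕ) {K : ℝ} (hK0 : 0 ≤ K)
    (hK : ∀ (W : Type) [Finite W] (F : SimpleGraph W), Nat.card W + 1 ≤ Nat.card U →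
      F.Connected → ∀ φ : H →g F, φ a = φ b → (numColorings F q : ℝ) ≤ K) :
    (numColoringsWith H q (fun c => c a = c b) : ℝ) ≤ K := by
  classical
  have hpos : 0 < Nat.card U := Nat.card_pos_iff.2 ⟨⟨a⟩, inferInstance⟩
  refine numColoringsWith_le_of_quotient hH q (Nat.card U - 1) hK0
    (fun x => if x = b then a else x) ?_ _ ?_ fun W _ F hW hF φ hφ => ?_
  · refine (ncard_range_le_of_notMem _ {b} fun x => ?_).trans (by simp)
    split_ifs with h <;> simp [hab, h]
  · intro c hc x y hxy
    split_ifs at hxy with h1 h2 h2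
    · rw [h1, h2]
    · rw [h1, ← hxy, hc]
    · rw [h2, hxy, hc]
    · rw [hxy]
  · exact hK W F (by omega) hF φ (hφ _ _ (by simp))

theorem numColoringsWith_splitsAs_le {U : Type} [Finite U] {H : SimpleGraph U}
    (hH : H.Connected) {S A : Finset U} {a b : U} (ha : a ∈ S) (hA : ∀ x ∈ A, x ∈ S ∧ x ≠ a)
    (hb : b ∈ S) (hba : b ≠ a) (hbA : b ∉ A) (q : ℕ) {K : ℝ} (hK0 : 0 ≤ K)
    (hK : ∀ (W : Type) [Finite W] (F : SimpleGraph W), Nat.card W + S.card ≤ Nat.card U + 2 →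
      F.Connected → ∀ φ : H →g F, (∀ x ∈ S, φ x = φ a ∨ φ x = φ b) →
      (numColorings F q : ℝ) ≤ K) :
    (numColoringsWith H q (SplitsAs q S a A) : ℝ) ≤ K := by
  classical
  have hle : S.card ≤ Nat.card U := by
    have := Set.ncard_le_card (S : Set U)
    rwa [Set.ncard_coe_finset] at this
  have hT : ((S.erase a).erase b).card + 2 = S.card := by
    have hbe : b ∈ S.erase a := Finset.mem_erase.2 ⟨hba, hb⟩
    have h1 := Finset.card_erase_add_one hbe
    have h2 := Finset.card_erase_add_one ha
    omega
  let g : U → U := fun x => if x ∈ A then a else if x ∈ S ∧ x ≠ a then b else x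
  have hg : ∀ c, SplitsAs q S a A c → ∀ x, c (g x) = c x := by
    intro c hc x
    simp only [g]
    split_ifs with h1 h2
    · exact (hc.1 x h1).symm
    · exact (hc.2 x h2.1 b hb h2.2 hba h1 hbA).symm
    · rfl
  refine numColoringsWith_le_of_quotient hH q (Nat.card U - ((S.erase a).erase b).card) hK0
    g (ncard_range_le_of_notMem _ _ fun x => ?_) _ ?_ fun W _ F hW hF φ hφ => ?_
  · simp only [g]
    split_ifs with h1 h2
    · simp
    · simp
    · simp only [Finset.mem_erase, not_and]
      intro _ hxa hxS
      exact h2 ⟨hxS, hxa⟩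
  · intro c hc x y hxy
    rw [← hg c hc x, ← hg c hc y, hxy]
  · refine hK W F (by omega) hF φ fun x hx => ?_
    have hga : g a = a := by
      have : a ∉ A := fun h => (hA a h).2 rfl
      simp [g, this]
    have hgb : g b = b := by simp [g, hbA]
    by_cases hxA : x ∈ A
    · exact Or.inl (hφ _ _ (by rw [hga]; simp [g, hxA]))
    · by_cases hxa : x = a
      · exact Or.inl (by rw [hxa])
      · exact Or.inr (hφ _ _ (by rw [hgb]; simp [g, hxA, hx, hxa]))

theorem card_compl_singleton_add_one {V : Type} [Finite V] (w : V) :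
    Nat.card ({w}ᶜ : Set V) + 1 = Nat.card V := by
  rw [Nat.card_coe_set_eq, Set.ncard_compl, Set.ncard_singleton]
  have : 0 < Nat.card V := Nat.card_pos_iff.2 ⟨⟨w⟩, inferInstance⟩
  omega

variable {V : Type} [Finite V] {G : SimpleGraph V} {w : V}

theorem numColorings_le_mul {x : V} (h : G.Adj w x) (s : ℕ) :
    (numColorings G (s + 1) : ℝ) ≤ s * numColorings (G.induce ({w}ᶜ : Set V)) (s + 1) := by
  exact_mod_cast numColorings_le_of_adj h (s + 1)

theorem numColorings_le_of_two_neighbors (hH : (G.induce ({w}ᶜ : Set V)).Connected)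
    {a b : V} (ha : G.Adj w a) (hb : G.Adj w b) (hab : a ≠ b) {s : ℕ} (hs : 1 ≤ s) {K : ℝ}
    (hK0 : 0 ≤ K)
    (hK : ∀ (W : Type) [Finite W] (F : SimpleGraph W), Nat.card W + 2 ≤ Nat.card V →
      F.Connected → ∀ φ : G.induce ({w}ᶜ : Set V) →g F, φ ⟨a, ha.ne'⟩ = φ ⟨b, hb.ne'⟩ →
      (numColorings F (s + 1) : ℝ) ≤ K) :
    (numColorings G (s + 1) : ℝ) ≤
      (s - 1) * numColorings (G.induce ({w}ᶜ : Set V)) (s + 1) + K := by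
  have h1 := numColorings_le_of_adj_of_adj (a := ⟨a, ha.ne'⟩) (b := ⟨b, hb.ne'⟩) ha hb
    (q := s + 1) (by omega)
  have h2 := numColoringsWith_pair_le hH (a := ⟨a, ha.ne'⟩) (b := ⟨b, hb.ne'⟩)
    (fun h => hab (congrArg Subtype.val h)) (s + 1) hK0 fun W _ F hW =>
      hK W F (by have := card_compl_singleton_add_one w; omega)
  have h3 : ((s + 1 - 2 : ℕ) : ℝ) = s - 1 := by
    rw [show s + 1 - 2 = s - 1 by omega, Nat.cast_sub hs, Nat.cast_one]
  have h4 : (numColorings G (s + 1) : ℝ) ≤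
      ((s + 1 - 2 : ℕ) : ℝ) * numColorings (G.induce ({w}ᶜ : Set V)) (s + 1) +
      numColoringsWith (G.induce ({w}ᶜ : Set V)) (s + 1)
        (fun c => c ⟨a, ha.ne'⟩ = c ⟨b, hb.ne'⟩) := by
    exact_mod_cast h1
  rw [h3] at h4
  linarith

theorem card_ssubsets_erase {U : Type} [DecidableEq U] {S : Finset U} {a : U} (ha : a ∈ S) :
    (S.erase a).ssubsets.card = 2 ^ (S.card - 1) - 1 := by
  rw [Finset.ssubsets, Finset.card_erase_of_mem (Finset.mem_powerset_self _),
    Finset.card_powerset, Finset.card_erase_of_mem ha]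

/-- Deleting a vertex with at least three neighbours `S`: the colourings using at most two colours
on `S` are controlled by graphs in which `S` has been contracted to two vertices. -/
theorem numColorings_le_of_many_neighbors (hH : (G.induce ({w}ᶜ : Set V)).Connected)
    {S : Finset ({w}ᶜ : Set V)} (hS : ∀ x ∈ S, G.Adj w x) (hcard : 3 ≤ S.card) {s : ℕ}
    (hs : 2 ≤ s) {K : ℝ} (hK0 : 0 ≤ K)
    (hK : ∀ (W : Type) [Finite W] (F : SimpleGraph W), Nat.card W + S.card ≤ Nat.card V + 1 →
      F.Connected → ∀ φ : G.induce ({w}ᶜ : Set V) →g F,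
      (∃ p r, ∀ x ∈ S, φ x = p ∨ φ x = r) → (numColorings F (s + 1) : ℝ) ≤ K) :
    (numColorings G (s + 1) : ℝ) ≤ (s - 2) * numColorings (G.induce ({w}ᶜ : Set V)) (s + 1) +
      (2 ^ (S.card - 1) - 1) * K ∧
    ((∃ a ∈ S, ∃ b ∈ S, G.Adj a b) ∨ 0 < numColoringsWith (G.induce ({w}ᶜ : Set V)) (s + 1)
        (fun c => ∀ x ∈ S, ∀ y ∈ S, c x = c y) → 0 < K →
      (numColorings G (s + 1) : ℝ) < (s - 2) * numColorings (G.induce ({w}ᶜ : Set V)) (s + 1) +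
        (2 ^ (S.card - 1) - 1) * K) := by
  classical
  have hN : ∀ a ∈ S, ∀ A ∈ (S.erase a).ssubsets,
      (numColoringsWith (G.induce ({w}ᶜ : Set V)) (s + 1) (SplitsAs (s + 1) S a A) : ℝ) ≤ K := by
    intro a ha A hA
    obtain ⟨hA1, hA2⟩ := Finset.mem_ssubsets.1 hA
    obtain ⟨b, hb, hbA⟩ := Finset.not_subset.1 hA2
    obtain ⟨hba, hbS⟩ := Finset.mem_erase.1 hb
    refine numColoringsWith_splitsAs_le hH ha (fun x hx => ?_) hbS hba hbA (s + 1) hK0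
      fun W _ F hW hF φ hφ =>
        hK W F (by have := card_compl_singleton_add_one w; omega) hF φ ⟨_, _, hφ⟩
    exact (Finset.mem_erase.1 (hA1 hx)).symm
  have hmain : ∀ a ∈ S, (numColorings G (s + 1) : ℝ) +
        numColoringsWith (G.induce ({w}ᶜ : Set V)) (s + 1) (fun c => ∀ x ∈ S, c x = c a) ≤
      (s - 2) * numColorings (G.induce ({w}ᶜ : Set V)) (s + 1) +
        ∑ A ∈ (S.erase a).ssubsets,
          (numColoringsWith (G.induce ({w}ᶜ : Set V)) (s + 1) (SplitsAs (s + 1) S a A) : ℝ) := by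
    intro a ha
    have h1 := numColorings_add_le_of_three_le_card hS ha hcard (q := s + 1) (by omega)
    have h3 : ((s + 1 - 3 : ℕ) : ℝ) = s - 2 := by
      rw [show s + 1 - 3 = s - 2 by omega, Nat.cast_sub hs, Nat.cast_ofNat]
    rw [← h3]
    exact_mod_cast h1
  have hsum : ∀ a ∈ S, ∑ _A ∈ (S.erase a).ssubsets, K = (2 ^ (S.card - 1) - 1) * K := by
    intro a ha
    rw [Finset.sum_const, card_ssubsets_erase ha, nsmul_eq_mul, Nat.cast_sub Nat.one_le_two_pow]
    push_cast
    rfl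
  obtain ⟨a₀, ha₀⟩ := Finset.card_pos.1 (by omega : 0 < S.card)
  refine ⟨?_, ?_⟩
  · have h1 := hmain a₀ ha₀
    have h2 := Finset.sum_le_sum (hN a₀ ha₀)
    rw [hsum a₀ ha₀] at h2
    have h3 : (0 : ℝ) ≤ numColoringsWith (G.induce ({w}ᶜ : Set V)) (s + 1)
      (fun c => ∀ x ∈ S, c x = c a₀) := Nat.cast_nonneg _
    linarith
  · rintro (⟨a, ha, b, hb, hab⟩ | hM) hKpos
    · have h1 := hmain a ha
      have hbe : b ∈ S.erase a := Finset.mem_erase.2 ⟨fun h => hab.ne (by rw [h]), hb⟩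
      have hbs : {b} ∈ (S.erase a).ssubsets := by
        rw [Finset.mem_ssubsets]
        refine ⟨Finset.singleton_subset_iff.2 hbe, fun h => ?_⟩
        have := Finset.card_le_card h
        rw [Finset.card_erase_of_mem ha, Finset.card_singleton] at this
        omega
      have hzero : (numColoringsWith (G.induce ({w}ᶜ : Set V)) (s + 1)
          (SplitsAs (s + 1) S a {b}) : ℝ) = 0 := by
        rw [numColoringsWith, Nat.cast_eq_zero]
        refine @Nat.card_of_isEmpty _ ⟨fun c => ?_⟩
        exact c.1.2 a b hab (c.2.1 b (Finset.mem_singleton_self b)).symm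
      have h2 := Finset.sum_lt_sum (hN a ha) ⟨{b}, hbs, hzero.trans_lt hKpos⟩
      rw [hsum a ha] at h2
      have h3 : (0 : ℝ) ≤ numColoringsWith (G.induce ({w}ᶜ : Set V)) (s + 1)
        (fun c => ∀ x ∈ S, c x = c a) := Nat.cast_nonneg _
      linarith
    · have h1 := hmain a₀ ha₀
      have h2 := Finset.sum_le_sum (hN a₀ ha₀)
      rw [hsum a₀ ha₀] at h2
      have h3 : (0 : ℝ) < numColoringsWith (G.induce ({w}ᶜ : Set V)) (s + 1)
          (fun c => ∀ x ∈ S, c x = c a₀) := by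
        rw [Nat.cast_pos]
        refine hM.trans_le (Nat.card_le_card_of_injective
          (fun c => ⟨c.1, fun x hx => c.2 x hx a₀ ha₀⟩) fun c c' h => ?_)
        have h4 := congrArg Subtype.val h
        exact Subtype.ext h4
      linarith

end Steps

section Structure

/-- A proper connected part of a connected graph can be extended to the complement of a vertex. -/
theorem exists_notMem_connected_compl {V : Type} [Finite V] {G : SimpleGraph V}
    (hG : G.Connected) {S : Set V} (hne : S.Nonempty) (hS : S ≠ Set.univ)
    (hc : (G.induce S).Connected) : ∃ w, w ∉ S ∧ (G.induce ({w}ᶜ : Set V)).Connected := by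
  obtain ⟨T, hST, hT⟩ := (Set.toFinite {T : Set V | T ≠ Set.univ ∧ (G.induce T).Connected}
    ).exists_le_maximal (a := S) ⟨hS, hc⟩
  obtain ⟨x, hx⟩ := (Set.ne_univ_iff_exists_notMem T).1 hT.prop.1
  obtain ⟨y, hy⟩ := hne
  obtain ⟨p⟩ := hG.preconnected y x
  obtain ⟨d, -, hd1, hd2⟩ := p.exists_boundary_dart T (hST hy) hx
  have hun : T ∪ {d.snd} = Set.univ := by
    by_contra hne
    have hconn : (G.induce (T ∪ {d.snd})).Connected :=
      SimpleGraph.connected_induce_union hT.prop.2.preconnected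
        (SimpleGraph.Preconnected.of_subsingleton) hd1 (Set.mem_singleton _) d.adj
    exact hd2 (hT.le_of_ge ⟨hne, hconn⟩ Set.subset_union_left (Set.mem_union_right _ rfl))
  have hTc : T = {d.snd}ᶜ := by
    ext z
    have hz : z ∈ T ∪ {d.snd} := hun ▸ Set.mem_univ z
    constructor
    · rintro h rfl
      exact hd2 h
    · intro h
      exact hz.resolve_right h
  refine ⟨d.snd, fun h => hd2 (hST h), ?_⟩
  rw [← hTc]
  exact hT.prop.2

theorem ncard_edgeSet_compl_singleton {V : Type} [Finite V] (G : SimpleGraph V) (w : V) :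
    (G.induce ({w}ᶜ : Set V)).edgeSet.ncard + (G.neighborSet w).ncard = G.edgeSet.ncard := by
  classical
  have := Fintype.ofFinite V
  have h1 := G.card_edgeFinset_induce_compl_singleton w
  rw [SimpleGraph.card_edgeFinset_deleteIncidenceSet] at h1
  have h2 : G.degree w ≤ G.edgeFinset.card := by
    rw [← G.card_incidenceFinset_eq_degree]
    exact Finset.card_le_card (G.incidenceFinset_subset w)
  have h3 : (G.neighborSet w).ncard = G.degree w := by
    rw [Set.ncard_eq_toFinset_card', ← SimpleGraph.card_neighborFinset_eq_degree]
    rfl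
  rw [← SimpleGraph.coe_edgeFinset, ← SimpleGraph.coe_edgeFinset, Set.ncard_coe_finset,
    Set.ncard_coe_finset, h3]
  omega

theorem sum_ncard_neighborSet {V : Type} [Fintype V] (G : SimpleGraph V) :
    ∑ v, (G.neighborSet v).ncard = 2 * G.edgeSet.ncard := by
  classical
  rw [← SimpleGraph.coe_edgeFinset, Set.ncard_coe_finset, ← G.sum_degrees_eq_twice_card_edges]
  refine Finset.sum_congr rfl fun v _ => ?_
  rw [Set.ncard_eq_toFinset_card', ← SimpleGraph.card_neighborFinset_eq_degree]
  rfl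

/-- `f 0, f 1, …, f l` is a closed walk in `G`. -/
def IsLoop {V : Type} (G : SimpleGraph V) (l : ℕ) (f : ℕ → V) : Prop :=
  f 0 = f l ∧ ∀ t < l, G.Adj (f t) (f (t + 1))

theorem IsLoop.not_colorable_two {V : Type} {G : SimpleGraph V} {l : ℕ} {f : ℕ → V}
    (h : IsLoop G l f) (hl : Odd l) {T : Set V} (hT : ∀ t < l, f t ∈ T) :
    ¬ (G.induce T).Colorable 2 := by
  classical
  rintro ⟨c⟩
  let c' : V → Fin 2 := fun x => if hx : x ∈ T then c ⟨x, hx⟩ else 0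
  have hl0 : 0 < l := hl.pos
  have hT' : ∀ t ≤ l, f t ∈ T := by
    intro t ht
    rcases ht.lt_or_eq with h1 | rfl
    · exact hT t h1
    · exact h.1 ▸ hT 0 hl0
  have hc' : ∀ t < l, c' (f t) ≠ c' (f (t + 1)) := by
    intro t ht
    simp only [c', hT' t ht.le, hT' (t + 1) ht, dite_true]
    exact c.valid (h.2 t ht)
  have key : ∀ t ≤ l, ((c' (f t)).val + (c' (f 0)).val) % 2 = t % 2 := by
    intro t
    induction t with
    | zero => intro _; omega
    | succ t ih =>
      intro ht
      have h1 := ih (by omega)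
      have h2 := hc' t (by omega)
      have h3 : (c' (f t)).val ≠ (c' (f (t + 1))).val := fun h => h2 (Fin.ext h)
      omega
  have := key l le_rfl
  rw [← h.1] at this
  have := Nat.odd_iff.1 hl
  omega

theorem exists_isLoop_of_not_colorable_two {V : Type} {G : SimpleGraph V}
    (h : ¬ G.Colorable 2) : ∃ l f, Odd l ∧ IsLoop G l f := by
  rw [SimpleGraph.two_colorable_iff_forall_loop_even] at h
  push Not at h
  obtain ⟨u, w, hw⟩ := h
  exact ⟨w.length, w.getVert, by simpa using hw, by simp, fun t ht => w.adj_getVert_succ ht⟩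

/-- A shortest odd closed walk is an induced cycle. -/
theorem exists_induced_odd_loop {V : Type} {G : SimpleGraph V} (h : ¬ G.Colorable 2) :
    ∃ l f, Odd l ∧ 3 ≤ l ∧ IsLoop G l f ∧ (∀ i j, i < j → j < l → f i ≠ f j) ∧
      ∀ i j, i < j → j < l → G.Adj (f i) (f j) → j = i + 1 ∨ (i = 0 ∧ j = l - 1) := by
  classical
  have hex : ∃ l, Odd l ∧ ∃ f, IsLoop G l f := by
    obtain ⟨l, f, hl, hf⟩ := exists_isLoop_of_not_colorable_two h
    exact ⟨l, hl, f, hf⟩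
  obtain ⟨hl, f, hf⟩ := Nat.find_spec hex
  have hmin : ∀ m < Nat.find hex, Odd m → ∀ g, ¬ IsLoop G m g :=
    fun m hm ho g hg => Nat.find_min hex hm ⟨ho, g, hg⟩
  set l := Nat.find hex
  have hl3 : 3 ≤ l := by
    have h1 : l ≠ 1 := by
      intro h1
      have h2 := hf.2 0 (by omega)
      rw [hf.1, h1] at h2
      exact h2.ne rfl
    obtain ⟨k, hk⟩ := hl
    omega
  refine ⟨l, f, hl, hl3, hf, fun i j hij hj heq => ?_, fun i j hij hj hadj => ?_⟩
  · rcases Nat.even_or_odd (j - i) with he | ho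
    · refine hmin (l - (j - i)) (by omega) (by grind)
        (fun t => if t ≤ i then f t else f (t + (j - i))) ⟨?_, fun t ht => ?_⟩
      · simp only [Nat.zero_le, if_true]
        rw [if_neg (by omega), hf.1]
        congr 1
        omega
      · by_cases h1 : t + 1 ≤ i
        · simp only [h1, (by omega : t ≤ i), if_true]
          exact hf.2 t (by omega)
        · by_cases h2 : t = i
          · subst h2
            simp only [le_refl, h1, if_true, if_false]
            rw [heq, show t + 1 + (j - t) = j + 1 by omega]
            exact hf.2 j hj
          · beta_reduce
            rw [if_neg (by omega : ¬ t ≤ i), if_neg h1]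
            rw [show t + 1 + (j - i) = t + (j - i) + 1 by omega]
            exact hf.2 _ (by omega)
    · refine hmin (j - i) (by omega) ho (fun t => f (i + t)) ⟨?_, fun t ht => ?_⟩
      · simp only [add_zero]
        rw [heq]
        congr 1
        omega
      · exact hf.2 (i + t) (by omega)
  · by_contra hne
    push Not at hne
    rcases Nat.even_or_odd (j - i) with he | ho
    · refine hmin (j - i + 1) (by omega) (by grind)
        (fun t => if t ≤ j - i then f (i + t) else f i) ⟨?_, fun t ht => ?_⟩
      · simp
      · by_cases h1 : t + 1 ≤ j - i
        · simp only [h1, (by omega : t ≤ j - i), if_true]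
          exact hf.2 (i + t) (by omega)
        · obtain rfl : t = j - i := by omega
          simp only [le_refl, h1, if_true, if_false]
          rw [show i + (j - i) = j by omega]
          exact hadj.symm
    · refine hmin (i + 1 + (l - j)) (by omega) (by grind)
        (fun t => if t ≤ i then f t else f (t - (i + 1) + j)) ⟨?_, fun t ht => ?_⟩
      · simp only [Nat.zero_le, if_true]
        rw [if_neg (by omega), hf.1]
        congr 1
        omega
      · by_cases h1 : t + 1 ≤ i
        · simp only [h1, (by omega : t ≤ i), if_true]
          exact hf.2 t (by omega)
        · by_cases h2 : t = i
          · subst h2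
            simp only [le_refl, h1, if_true, if_false]
            rw [show t + 1 - (t + 1) + j = j by omega]
            exact hadj
          · beta_reduce
            rw [if_neg (by omega : ¬ t ≤ i), if_neg h1]
            rw [show t + 1 - (i + 1) + j = t - (i + 1) + j + 1 by omega]
            exact hf.2 _ (by omega)

theorem five_le_card_of_not_colorable_two {V : Type} [Finite V] {G : SimpleGraph V}
    (h : ¬ G.Colorable 2) (h3 : ∀ a b c, G.Adj a b → G.Adj b c → ¬ G.Adj c a) :
    5 ≤ Nat.card V := by
  obtain ⟨l, f, hl, hl3, hf, hinj, -⟩ := exists_induced_odd_loop h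
  have hne3 : l ≠ 3 := by
    rintro rfl
    refine h3 (f 0) (f 1) (f 2) (hf.2 0 (by omega)) (hf.2 1 (by omega)) ?_
    rw [hf.1]
    exact hf.2 2 (by omega)
  have hl5 : 5 ≤ l := by
    obtain ⟨k, hk⟩ := hl
    omega
  have hcard : l ≤ Nat.card V := by
    have h1 : Function.Injective (fun i : Fin l => f i) := by
      intro i j hij
      by_contra hne
      rcases lt_or_gt_of_ne (fun h => hne (Fin.ext h)) with h | h
      · exact hinj i j h j.2 hij
      · exact hinj j i h i.2 hij.symm
    simpa using Nat.card_le_card_of_injective _ h1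
  omega

theorem IsLoop.induce_connected {V : Type} {G : SimpleGraph V} {l : ℕ} {f : ℕ → V}
    (h : IsLoop G l f) (hl : 0 < l) : (G.induce (f '' Set.Iio l)).Connected := by
  rw [SimpleGraph.connected_iff_exists_forall_reachable]
  refine ⟨⟨f 0, 0, hl, rfl⟩, ?_⟩
  rintro ⟨_, t, ht, rfl⟩
  induction t with
  | zero => exact SimpleGraph.Reachable.refl _
  | succ t ih =>
    have ht' : t < l := Nat.lt_of_succ_lt ht
    refine (ih ht').trans (SimpleGraph.Adj.reachable ?_)
    exact h.2 t ht'

/-- A connected non-bipartite graph other than an odd cycle has a vertex whose deletion leaves it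
connected and non-bipartite. -/
theorem exists_connected_not_colorable_two_compl {V : Type} [Finite V] {G : SimpleGraph V}
    (hG : G.Connected) (h : ¬ G.Colorable 2) (hE : Nat.card V < G.edgeSet.ncard) :
    ∃ w, (G.induce ({w}ᶜ : Set V)).Connected ∧ ¬ (G.induce ({w}ᶜ : Set V)).Colorable 2 := by
  obtain ⟨l, f, hl, hl3, hf, hinj, hch⟩ := exists_induced_odd_loop h
  by_cases huniv : f '' Set.Iio l = Set.univ
  · exfalso
    have hdeg : ∀ v, (G.neighborSet v).ncard ≤ 2 := by
      intro v
      obtain ⟨i, hi, rfl⟩ := (huniv ▸ Set.mem_univ v : v ∈ f '' Set.Iio l)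
      have hi' : i < l := hi
      have hsub : G.neighborSet (f i) ⊆
          {f (if i + 1 < l then i + 1 else 0), f (if i = 0 then l - 1 else i - 1)} := by
        intro y hy
        obtain ⟨j, hj, rfl⟩ := (huniv ▸ Set.mem_univ y : y ∈ f '' Set.Iio l)
        have hj' : j < l := hj
        have hy' : G.Adj (f i) (f j) := hy
        rcases lt_trichotomy i j with hij | rfl | hij
        · rcases hch i j hij hj' hy' with rfl | ⟨rfl, rfl⟩
          · left; rw [if_pos hj']
          · right; simp
        · exact absurd rfl hy'.ne
        · rcases hch j i hij hi' hy'.symm with rfl | ⟨rfl, rfl⟩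
          · right; simp
          · left
            rw [if_neg (by omega)]
      refine (Set.ncard_le_ncard hsub).trans ((Set.ncard_insert_le _ _).trans ?_)
      rw [Set.ncard_singleton]
    have := Fintype.ofFinite V
    have h1 := sum_ncard_neighborSet G
    have h2 := Finset.sum_le_sum (fun v (_ : v ∈ Finset.univ) => hdeg v)
    rw [Finset.sum_const, Finset.card_univ, ← Nat.card_eq_fintype_card, smul_eq_mul] at h2
    omega
  · obtain ⟨w, hw, hwc⟩ := exists_notMem_connected_compl hG
      (Set.Nonempty.image f ⟨0, Set.mem_Iio.2 (by omega)⟩) huniv (hf.induce_connected (by omega))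
    refine ⟨w, hwc, hf.not_colorable_two hl fun t ht => ?_⟩
    rintro rfl
    exact hw ⟨t, ht, rfl⟩

/-- `G` contains a triangle. -/
def HasTriangle {V : Type} (G : SimpleGraph V) : Prop :=
  ∃ a b c, G.Adj a b ∧ G.Adj b c ∧ G.Adj a c

theorem HasTriangle.map {V W : Type} {G : SimpleGraph V} {H : SimpleGraph W} (h : HasTriangle G)
    (φ : G →g H) : HasTriangle H := by
  obtain ⟨a, b, c, h1, h2, h3⟩ := h
  exact ⟨φ a, φ b, φ c, φ.map_adj h1, φ.map_adj h2, φ.map_adj h3⟩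

theorem induce_triangle_connected {V : Type} {G : SimpleGraph V} {a b c : V} (h1 : G.Adj a b)
    (h2 : G.Adj b c) : (G.induce ({a, b, c} : Set V)).Connected := by
  rw [SimpleGraph.connected_iff_exists_forall_reachable]
  refine ⟨⟨b, by simp⟩, ?_⟩
  rintro ⟨x, rfl | rfl | rfl⟩
  · exact SimpleGraph.Adj.reachable (by exact h1.symm)
  · exact SimpleGraph.Reachable.refl _
  · exact SimpleGraph.Adj.reachable (by exact h2)

theorem exists_connected_hasTriangle_compl {V : Type} [Finite V] {G : SimpleGraph V}
    (hG : G.Connected) (h : HasTriangle G) (hV : 3 < Nat.card V) :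
    ∃ w, (G.induce ({w}ᶜ : Set V)).Connected ∧ HasTriangle (G.induce ({w}ᶜ : Set V)) := by
  obtain ⟨a, b, c, h1, h2, h3⟩ := h
  have huniv : ({a, b, c} : Set V) ≠ Set.univ := by
    intro h
    have h4 : Nat.card V ≤ 3 := by
      rw [← Set.ncard_univ, ← h]
      refine (Set.ncard_insert_le _ _).trans (Nat.succ_le_succ
        ((Set.ncard_insert_le _ _).trans ?_))
      rw [Set.ncard_singleton]
    omega
  obtain ⟨w, hw, hwc⟩ := exists_notMem_connected_compl hG (by simp) huniv
    (induce_triangle_connected h1 h2)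
  simp only [Set.mem_insert_iff, Set.mem_singleton_iff, not_or] at hw
  exact ⟨w, hwc, ⟨a, Ne.symm hw.1⟩, ⟨b, Ne.symm hw.2.1⟩, ⟨c, Ne.symm hw.2.2⟩, h1, h2, h3⟩

theorem ncard_edgeSet_le_choose {V : Type} [Finite V] (G : SimpleGraph V) :
    G.edgeSet.ncard ≤ (Nat.card V).choose 2 := by
  classical
  have := Fintype.ofFinite V
  rw [← SimpleGraph.coe_edgeFinset, Set.ncard_coe_finset, Nat.card_eq_fintype_card]
  exact SimpleGraph.card_edgeFinset_le_card_choose_two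

end Structure

section Bounds

theorem numColorings_le_pow {V : Type} [Finite V] (G : SimpleGraph V) (q : ℕ) :
    numColorings G q ≤ q ^ Nat.card V := by
  have h := Nat.card_le_card_of_injective (fun c : ProperColoring G q => c.1)
    Subtype.val_injective
  rwa [Nat.card_fun, Nat.card_fin] at h

theorem exists_adj_of_connected_compl {V : Type} [Finite V] {G : SimpleGraph V}
    (hG : G.Connected) {w : V} (hH : (G.induce ({w}ᶜ : Set V)).Connected) : ∃ x, G.Adj w x := by
  obtain ⟨z⟩ := hH.nonempty
  have : Nontrivial V := ⟨⟨w, z, fun h => z.2 h.symm⟩⟩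
  exact hG.preconnected.exists_adj_of_nontrivial w

/-- A coloring of `G - w` missing a colour around `w` extends to `G`. -/
theorem colorable_of_missing_color {V : Type} {G : SimpleGraph V} {w : V} {k : ℕ}
    (c : (G.induce ({w}ᶜ : Set V)).Coloring (Fin k)) (i : Fin k)
    (hi : ∀ x : ({w}ᶜ : Set V), G.Adj w x → c x ≠ i) : G.Colorable k := by
  classical
  refine ⟨SimpleGraph.Coloring.mk (fun x => if h : x = w then i else c ⟨x, h⟩) ?_⟩
  intro u v huv
  by_cases hu : u = w
  · subst hu
    have hv : v ≠ u := huv.ne'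
    simpa [hv] using (hi ⟨v, hv⟩ huv).symm
  · by_cases hv : v = w
    · subst hv
      simpa [hu] using hi ⟨u, hu⟩ huv.symm
    · simpa [hu, hv] using c.valid (v := ⟨u, hu⟩) (w := ⟨v, hv⟩) huv

theorem eq_iff_eq_of_two_colorings {U : Type} {H : SimpleGraph U}
    (c d : H.Coloring (Fin 2)) {x y : U} (h : H.Reachable x y) : c x = c y ↔ d x = d y := by
  obtain ⟨p⟩ := h
  induction p with
  | nil => simp
  | cons h p ih =>
    have h1 := c.valid h
    have h2 := d.valid h
    rename_i u v w
    generalize c u = a at *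
    generalize c v = b at *
    generalize c w = e at *
    generalize d u = a' at *
    generalize d v = b' at *
    generalize d w = e' at *
    omega

theorem numColorings_le_tree {s : ℕ} (hs : 1 ≤ s) (n : ℕ) :
    ∀ (V : Type) [Finite V] (G : SimpleGraph V), G.Connected → Nat.card V ≤ n + 1 →
      (numColorings G (s + 1) : ℝ) ≤ (s + 1) * s ^ n := by
  have hs' : (1 : ℝ) ≤ s := by exact_mod_cast hs
  induction n with
  | zero =>
    intro V _ G hG hn
    have h := numColorings_le_pow G (s + 1)
    have h2 := Nat.pow_le_pow_right (Nat.succ_pos s) hn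
    have : numColorings G (s + 1) ≤ s + 1 := by simpa using h.trans h2
    simpa using (by exact_mod_cast this : (numColorings G (s + 1) : ℝ) ≤ s + 1)
  | succ n ih =>
    intro V _ G hG hn
    by_cases hV : Nontrivial V
    · obtain ⟨w, hw⟩ := hG.exists_connected_induce_compl_singleton_of_finite_nontrivial
      obtain ⟨x, hx⟩ := exists_adj_of_connected_compl hG hw
      have h1 := numColorings_le_mul hx s
      have h2 := ih _ _ hw (by have := card_compl_singleton_add_one w; omega)
      calc _ ≤ _ := h1
        _ ≤ (s : ℝ) * ((s + 1) * s ^ n) := by gcongr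
        _ = _ := by ring
    · have hsub := not_nontrivial_iff_subsingleton.1 hV
      have h1 : Nat.card V ≤ n + 1 := (Finite.card_le_one_iff_subsingleton.2 hsub).trans (by omega)
      refine (ih V G hG h1).trans ?_
      gcongr
      · omega

theorem numColorings_le_of_not_colorable_two {s : ℕ} (hs : 2 ≤ s) (n : ℕ) :
    ∀ (V : Type) [Finite V] (G : SimpleGraph V), G.Connected → ¬ G.Colorable 2 →
      Nat.card V ≤ n → (numColorings G (s + 1) : ℝ) ≤ s ^ n := by
  have hs' : (2 : ℝ) ≤ s := by exact_mod_cast hs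
  induction n using Nat.strong_induction_on with
  | _ n ih =>
    intro V _ G hG h2 hn
    have hV : Nontrivial V := by
      by_contra hV
      have := not_nontrivial_iff_subsingleton.1 hV
      exact h2 ⟨SimpleGraph.Coloring.mk (fun _ => 0) fun {u v} h =>
        absurd (Subsingleton.elim u v) h.ne⟩
    obtain ⟨w, hw⟩ := hG.exists_connected_induce_compl_singleton_of_finite_nontrivial
    obtain ⟨x, hx⟩ := exists_adj_of_connected_compl hG hw
    have hcard := card_compl_singleton_add_one w
    have hn2 : 2 ≤ n := (Finite.one_lt_card (α := V)).trans_le hn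
    obtain ⟨k, rfl⟩ := Nat.exists_eq_add_of_le hn2
    rw [Nat.add_comm 2 k] at *
    by_cases hH : (G.induce ({w}ᶜ : Set V)).Colorable 2
    · obtain ⟨c⟩ := hH
      have hab : ∃ b : ({w}ᶜ : Set V), G.Adj w b ∧ c ⟨x, hx.ne'⟩ ≠ c b := by
        by_contra hall
        push Not at hall
        refine h2 (colorable_of_missing_color c (1 - c ⟨x, hx.ne'⟩) fun y hy => ?_)
        rw [← hall y hy]
        generalize c ⟨x, hx.ne'⟩ = z
        revert z
        decide
      obtain ⟨b, hb, hcb⟩ := hab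
      have h3 := numColorings_le_of_two_neighbors (K := (s : ℝ) ^ k) hw hx hb
        (fun h => hcb (congrArg c (Subtype.ext h))) (by omega : 1 ≤ s) (by positivity)
        fun W _ F hW hF φ hφ => ?_
      · have h4 := numColorings_le_tree (by omega : 1 ≤ s) k _ _ hw (by omega)
        calc _ ≤ _ := h3
          _ ≤ ((s : ℝ) - 1) * ((s + 1) * s ^ k) + s ^ k := by
            have : (0 : ℝ) ≤ (s : ℝ) - 1 := by linarith
            gcongr
          _ = _ := by ring
      · refine ih k (by omega) W F hF ?_ (by omega)
        rintro ⟨d⟩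
        have hd : (d.comp φ) ⟨x, hx.ne'⟩ = (d.comp φ) b := congrArg d hφ
        exact hcb ((eq_iff_eq_of_two_colorings c (d.comp φ) (hw.preconnected _ _)).2 hd)
    · have h3 := ih (k + 1) (by omega) _ _ hw hH (by omega)
      calc _ ≤ _ := numColorings_le_mul hx s
        _ ≤ (s : ℝ) * s ^ (k + 1) := by gcongr
        _ = _ := by ring

theorem HasTriangle.not_colorable_two {V : Type} {G : SimpleGraph V} (h : HasTriangle G) :
    ¬ G.Colorable 2 := by
  rintro ⟨f⟩
  obtain ⟨a, b, c, h1, h2, h3⟩ := h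
  have h1 := f.valid h1
  have h2 := f.valid h2
  have h3 := f.valid h3
  generalize f a = x at *
  generalize f b = y at *
  generalize f c = z at *
  omega

theorem numColorings_le_of_hasTriangle {s : ℕ} (hs : 2 ≤ s) (n : ℕ) :
    ∀ (V : Type) [Finite V] (G : SimpleGraph V), G.Connected → HasTriangle G →
      Nat.card V ≤ n + 3 → (numColorings G (s + 1) : ℝ) ≤ (s ^ 2 - 1) * s ^ (n + 1) := by
  have hs' : (2 : ℝ) ≤ s := by exact_mod_cast hs
  have hs1 : (0 : ℝ) ≤ (s : ℝ) ^ 2 - 1 := by nlinarith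
  induction n with
  | zero =>
    intro V _ G hG h hn
    obtain ⟨a, b, c, h1, h2, h3⟩ := h
    have huniv : ({a, b, c} : Set V) = Set.univ := by
      refine Set.eq_of_subset_of_ncard_le (Set.subset_univ _) ?_
      have h4 : ({a, b, c} : Set V).ncard = 3 := by
        rw [Set.ncard_eq_three]
        exact ⟨a, b, c, h1.ne, h3.ne, h2.ne, rfl⟩
      rw [Set.ncard_univ, h4]
      exact hn
    have hH : (G.induce ({c}ᶜ : Set V)).Connected := by
      have h4 : ({c}ᶜ : Set V) = {a, b} := by
        ext x
        have hx : x ∈ ({a, b, c} : Set V) := huniv ▸ Set.mem_univ x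
        simp only [Set.mem_insert_iff, Set.mem_singleton_iff] at hx
        simp only [Set.mem_compl_iff, Set.mem_insert_iff, Set.mem_singleton_iff]
        constructor
        · intro h
          tauto
        · rintro (rfl | rfl)
          · exact h3.ne
          · exact h2.ne
      rw [h4]
      exact SimpleGraph.induce_pair_connected_of_adj h1
    have h5 := numColorings_le_of_two_neighbors (K := 0) hH h3.symm h2.symm h1.ne (by omega : 1 ≤ s)
      le_rfl fun W _ F hW hF φ hφ => ?_
    · have h6 := numColorings_le_tree (by omega : 1 ≤ s) 1 _ _ hH
        (by have := card_compl_singleton_add_one c; omega)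
      calc _ ≤ _ := h5
        _ ≤ ((s : ℝ) - 1) * ((s + 1) * s ^ 1) + 0 := by
          have : (0 : ℝ) ≤ (s : ℝ) - 1 := by linarith
          gcongr
        _ = _ := by ring
    · have h7 : (G.induce ({c}ᶜ : Set V)).Adj ⟨a, h3.ne⟩ ⟨b, h2.ne⟩ := h1
      exact absurd hφ (φ.map_adj h7).ne
  | succ n ih =>
    intro V _ G hG h hn
    by_cases hV : 3 < Nat.card V
    · obtain ⟨w, hw, ht⟩ := exists_connected_hasTriangle_compl hG h hV
      obtain ⟨x, hx⟩ := exists_adj_of_connected_compl hG hw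
      have h2 := ih _ _ hw ht (by have := card_compl_singleton_add_one w; omega)
      calc _ ≤ _ := numColorings_le_mul hx s
        _ ≤ (s : ℝ) * ((s ^ 2 - 1) * s ^ (n + 1)) := by gcongr
        _ = _ := by ring
    · refine (ih V G hG h (by omega)).trans ?_
      gcongr
      · linarith
      · omega

theorem exists_finset_neighbors {V : Type} [Finite V] (G : SimpleGraph V) (w : V) :
    ∃ S : Finset ({w}ᶜ : Set V), (∀ x, x ∈ S ↔ G.Adj w x) ∧
      S.card = (G.neighborSet w).ncard := by
  classical
  have := Fintype.ofFinite V
  refine ⟨Finset.univ.filter fun x => G.Adj w x, by simp, ?_⟩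
  rw [← Set.ncard_coe_finset, ← Set.ncard_image_of_injective _ Subtype.val_injective]
  congr 1
  ext x
  simp only [Finset.coe_filter, Finset.mem_univ, true_and, Set.mem_image, Set.mem_ofPred_eq,
    SimpleGraph.mem_neighborSet]
  constructor
  · rintro ⟨y, hy, rfl⟩
    exact hy
  · intro h
    exact ⟨⟨x, h.ne'⟩, h, rfl⟩

end Bounds

section Excess

/-- Bounds for connected graphs in a class of graphs closed under homomorphic images: the more edges
a graph has in excess of its order, the fewer colourings it has. -/
theorem numColorings_le_of_excess {s : ℕ} (hs : 3 ≤ s) {κ : ℝ} (hκ : 0 ≤ κ)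
    (Q : ∀ W : Type, SimpleGraph W → Prop)
    (hom : ∀ (V W : Type) (G : SimpleGraph V) (H : SimpleGraph W), (G →g H) → Q V G → Q W H)
    (bound : ∀ (W : Type) [Finite W] (F : SimpleGraph W) (m : ℕ), F.Connected → Q W F →
      Nat.card W ≤ m → (numColorings F (s + 1) : ℝ) ≤ κ * s ^ m)
    (hdel : ∀ (W : Type) [Finite W] (F : SimpleGraph W), F.Connected → Q W F →
      Nat.card W < F.edgeSet.ncard → ∃ w, (F.induce ({w}ᶜ : Set W)).Connected ∧
        Q ({w}ᶜ : Set W) (F.induce ({w}ᶜ : Set W))) (n : ℕ) :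
    ∀ (V : Type) [Finite V] (G : SimpleGraph V), G.Connected → Q V G → Nat.card V = n →
      (n + 1 ≤ G.edgeSet.ncard →
        (numColorings G (s + 1) : ℝ) ≤ κ * s ^ n * (1 - 1 / s + 1 / s ^ 2)) ∧
      (n + 2 ≤ G.edgeSet.ncard →
        (numColorings G (s + 1) : ℝ) ≤ κ * s ^ n * (1 - 2 / s + 3 / s ^ 2)) ∧
      (n + 3 ≤ G.edgeSet.ncard →
        (numColorings G (s + 1) : ℝ) ≤ κ * s ^ n * ((1 - 1 / s ^ 2) * (1 - 3 / s ^ 2))) := by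
  have hs' : (3 : ℝ) ≤ s := by exact_mod_cast hs
  have hs0 : (0 : ℝ) < s := by linarith
  set ρ₁ : ℝ := 1 - 1 / s + 1 / s ^ 2 with hρ₁
  set ρ₂ : ℝ := 1 - 2 / s + 3 / s ^ 2 with hρ₂
  set τ : ℝ := (1 - 1 / s ^ 2) * (1 - 3 / s ^ 2) with hτ
  have e1 : (s - 1) * s + 1 ≤ ρ₁ * s ^ 2 := by
    rw [hρ₁]; field_simp; nlinarith
  have e2 : (s - 1) * (s * ρ₁) + 1 ≤ ρ₂ * s ^ 2 := by
    rw [hρ₁, hρ₂]; field_simp; nlinarith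
  have e3 : (s - 2) * s + 3 ≤ ρ₂ * s ^ 2 := by
    rw [hρ₂]; field_simp; nlinarith
  have e4 : (s - 1) * (s * ρ₂) + 1 ≤ τ * s ^ 2 := by
    rw [hτ, hρ₂]; field_simp
    nlinarith [mul_nonneg (sub_nonneg.2 hs') (by nlinarith : (0 : ℝ) ≤ 3 * s ^ 2 - s - 1)]
  have e5 : (s - 2) * (s * ρ₁) + 3 ≤ τ * s ^ 2 := by
    rw [hτ, hρ₁]; field_simp
    nlinarith [mul_nonneg (sub_nonneg.2 hs') (by nlinarith : (0 : ℝ) ≤ 3 * s ^ 2 - s - 1)]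
  have e6 : (s - 2) * s + 7 / s ≤ τ * s ^ 2 := by
    rw [hτ]; field_simp
    nlinarith [mul_nonneg (sub_nonneg.2 hs') (by nlinarith : (0 : ℝ) ≤ 2 * s ^ 2 + 2 * s - 1)]
  clear_value ρ₁ ρ₂ τ
  induction n using Nat.strong_induction_on with
  | _ n ih =>
    intro V _ G hG hQ hn
    by_cases hE : n < G.edgeSet.ncard
    swap
    · exact ⟨fun h => by omega, fun h => by omega, fun h => by omega⟩
    obtain ⟨w, hw, hQw⟩ := hdel V G hG hQ (by omega)
    obtain ⟨x, hx⟩ := exists_adj_of_connected_compl hG hw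
    have hcard := card_compl_singleton_add_one w
    have hedge := ncard_edgeSet_compl_singleton G w
    obtain ⟨z⟩ := hw.nonempty
    have hpos : 0 < Nat.card ({w}ᶜ : Set V) := Nat.card_pos_iff.2 ⟨⟨z⟩, inferInstance⟩
    obtain ⟨k, rfl⟩ : ∃ k, n = k + 2 := ⟨n - 2, by omega⟩
    obtain ⟨ih1, ih2, ih3⟩ := ih (k + 1) (by omega) _ _ hw hQw (by omega)
    have ih0 := bound _ _ (k + 1) hw hQw (by omega)
    set H := G.induce ({w}ᶜ : Set V) with hH
    have hstep : ∀ c d r ρ : ℝ, 0 ≤ c → (numColorings H (s + 1) : ℝ) ≤ κ * s ^ (k + 1) * r →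
        (numColorings G (s + 1) : ℝ) ≤ c * numColorings H (s + 1) + d * (κ * s ^ k) →
        c * (s * r) + d ≤ ρ * s ^ 2 → (numColorings G (s + 1) : ℝ) ≤ κ * s ^ (k + 2) * ρ := by
      intro c d r ρ hc h1 h2 h3
      calc _ ≤ _ := h2
        _ ≤ c * (κ * s ^ (k + 1) * r) + d * (κ * s ^ k) := by gcongr
        _ = κ * s ^ k * (c * (s * r) + d) := by ring
        _ ≤ κ * s ^ k * (ρ * s ^ 2) := by gcongr
        _ = _ := by ring
    have hb1 : 1 ≤ (G.neighborSet w).ncard := (Set.ncard_pos (Set.toFinite _)).2 ⟨x, hx⟩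
    rcases hb1.eq_or_lt with hb | hb
    · have hG1 : (numColorings G (s + 1) : ℝ) ≤ s * numColorings H (s + 1) + 0 * (κ * s ^ k) := by
        rw [zero_mul, add_zero]
        exact numColorings_le_mul hx s
      refine ⟨fun h => ?_, fun h => ?_, fun h => ?_⟩
      · exact hstep s 0 _ _ hs0.le (ih1 (by omega)) hG1 (by ring_nf; rfl)
      · exact hstep s 0 _ _ hs0.le (ih2 (by omega)) hG1 (by ring_nf; rfl)
      · exact hstep s 0 _ _ hs0.le (ih3 (by omega)) hG1 (by ring_nf; rfl)
    · obtain ⟨a, ha, b, hbn, hab⟩ := (Set.one_lt_ncard).1 hb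
      have hG2 : (numColorings G (s + 1) : ℝ) ≤
          (s - 1) * numColorings H (s + 1) + 1 * (κ * s ^ k) :=
        (one_mul (κ * (s : ℝ) ^ k)).symm ▸
          numColorings_le_of_two_neighbors hw ha hbn hab (by omega : 1 ≤ s) (by positivity)
            fun W _ F hW hF φ _ => bound W F k hF (hom _ _ _ _ φ hQw) (by omega)
      have hG3 : 3 ≤ (G.neighborSet w).ncard → (numColorings G (s + 1) : ℝ) ≤
          (s - 2) * numColorings H (s + 1) + 3 * (κ * s ^ k) := by
        intro hb3
        obtain ⟨S', hS', hS'c⟩ := exists_finset_neighbors G w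
        obtain ⟨S, hSS, hSc⟩ := Finset.exists_subset_card_eq (hS'c.symm ▸ hb3)
        have h := (numColorings_le_of_many_neighbors (K := κ * s ^ k) hw
          (fun x hx => (hS' x).1 (hSS hx)) hSc.ge (by omega : 2 ≤ s) (by positivity)
          fun W _ F hW hF φ _ => bound W F k hF (hom _ _ _ _ φ hQw) (by omega)).1
        rw [hSc] at h
        norm_num at h
        exact h
      have hG4 : 4 ≤ (G.neighborSet w).ncard → (numColorings G (s + 1) : ℝ) ≤
          (s - 2) * numColorings H (s + 1) + (7 / s) * (κ * s ^ k) := by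
        intro hb4
        obtain ⟨S', hS', hS'c⟩ := exists_finset_neighbors G w
        obtain ⟨S, hSS, hSc⟩ := Finset.exists_subset_card_eq (hS'c.symm ▸ hb4)
        have h5 : 1 ≤ k := by
          have : (G.neighborSet w).ncard ≤ Nat.card ({w}ᶜ : Set V) := by
            rw [Nat.card_coe_set_eq]
            exact Set.ncard_le_ncard fun y hy => hy.ne'
          omega
        obtain ⟨j, rfl⟩ := Nat.exists_eq_add_of_le' h5
        have h := (numColorings_le_of_many_neighbors (K := κ * s ^ j) hw
          (fun x hx => (hS' x).1 (hSS hx)) (by omega) (by omega : 2 ≤ s) (by positivity)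
          fun W _ F hW hF φ _ => bound W F j hF (hom _ _ _ _ φ hQw) (by omega)).1
        rw [hSc] at h
        norm_num at h
        refine h.trans_eq ?_
        rw [pow_succ, add_right_inj]
        field_simp
      have hc1 : (0 : ℝ) ≤ s - 1 := by linarith
      have hc2 : (0 : ℝ) ≤ s - 2 := by linarith
      have ih0' : (numColorings H (s + 1) : ℝ) ≤ κ * s ^ (k + 1) * 1 := by rwa [mul_one]
      refine ⟨fun h => ?_, fun h => ?_, fun h => ?_⟩
      · exact hstep _ _ _ _ hc1 ih0' hG2 (by rwa [mul_one])
      · rcases (Nat.succ_le_of_lt hb).eq_or_lt with hb2 | hb2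
        · exact hstep _ _ _ _ hc1 (ih1 (by omega)) hG2 e2
        · exact hstep _ _ _ _ hc2 ih0' (hG3 hb2) (by rwa [mul_one])
      · rcases (Nat.succ_le_of_lt hb).eq_or_lt with hb2 | hb2
        · exact hstep _ _ _ _ hc1 (ih2 (by omega)) hG2 e4
        · rcases (Nat.succ_le_of_lt hb2).eq_or_lt with hb3 | hb3
          · exact hstep _ _ _ _ hc2 (ih1 (by omega)) (hG3 hb2) e5
          · exact hstep _ _ _ _ hc2 ih0' (hG4 hb3) (by rwa [mul_one])

theorem numColorings_le_of_three_extra_edges {s : ℕ} (hs : 3 ≤ s) {V : Type} [Finite V]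
    {G : SimpleGraph V} (hG : G.Connected) (h : ¬ G.Colorable 2)
    (hE : Nat.card V + 3 ≤ G.edgeSet.ncard) :
    (numColorings G (s + 1) : ℝ) ≤
      s ^ Nat.card V * ((1 - 1 / s ^ 2) * (1 - 3 / s ^ 2)) := by
  have h1 := (numColorings_le_of_excess hs zero_le_one (fun _ G => ¬ G.Colorable 2)
    (fun V W G H φ h1 ⟨c⟩ => h1 ⟨c.comp φ⟩)
    (fun W _ F m hF hQ hm => by
      rw [one_mul]; exact numColorings_le_of_not_colorable_two (by omega) m W F hF hQ hm)
    (fun W _ F hF hQ hE => exists_connected_not_colorable_two_compl hF hQ hE)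
    _ V G hG h rfl).2.2 hE
  rwa [one_mul] at h1

theorem HasTriangle.three_le_card {V : Type} [Finite V] {G : SimpleGraph V} (h : HasTriangle G) :
    3 ≤ Nat.card V := by
  obtain ⟨a, b, c, h1, h2, h3⟩ := h
  have h4 : ({a, b, c} : Set V).ncard = 3 := by
    rw [Set.ncard_eq_three]
    exact ⟨a, b, c, h1.ne, h3.ne, h2.ne, rfl⟩
  rw [← h4]
  exact Set.ncard_le_card _

theorem numColorings_le_of_hasTriangle_of_two_extra_edges {s : ℕ} (hs : 3 ≤ s) {V : Type}
    [Finite V] {G : SimpleGraph V} (hG : G.Connected) (h : HasTriangle G)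
    (hE : Nat.card V + 2 ≤ G.edgeSet.ncard) :
    (numColorings G (s + 1) : ℝ) ≤
      s ^ Nat.card V * ((1 - 1 / s ^ 2) * (1 - 3 / s ^ 2)) := by
  have hs' : (3 : ℝ) ≤ s := by exact_mod_cast hs
  have hκ : (0 : ℝ) ≤ 1 - 1 / s ^ 2 := by
    rw [sub_nonneg, div_le_one (by positivity)]
    nlinarith
  have h1 := (numColorings_le_of_excess hs hκ (fun _ G => HasTriangle G)
    (fun V W G H φ h1 => h1.map φ)
    (fun W _ F m hF hQ hm => by
      have h3 := hQ.three_le_card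
      obtain ⟨j, rfl⟩ : ∃ j, m = j + 3 := ⟨m - 3, by omega⟩
      refine (numColorings_le_of_hasTriangle (by omega) j W F hF hQ hm).trans_eq ?_
      field_simp
      ring)
    (fun W _ F hF hQ hE => by
      refine exists_connected_hasTriangle_compl hF hQ ?_
      have h3 := hQ.three_le_card
      by_contra h4
      have h5 : Nat.card W = 3 := by omega
      have h6 := ncard_edgeSet_le_choose F
      rw [h5] at h6 hE
      exact absurd (hE.trans_le h6) (by decide))
    _ V G hG h rfl).2.1 hE
  refine h1.trans ?_
  rw [mul_comm (1 - 1 / (s : ℝ) ^ 2), mul_assoc]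
  refine mul_le_mul_of_nonneg_left (mul_le_mul_of_nonneg_left ?_ hκ) (by positivity)
  rw [sub_add, sub_le_sub_iff_left]
  rw [div_sub_div _ _ (by positivity) (by positivity), div_le_div_iff₀ (by positivity)
    (by positivity)]
  nlinarith [mul_nonneg (by linarith : (0 : ℝ) ≤ s - 3) (by positivity : (0 : ℝ) ≤ s ^ 3)]

end Excess

section Critical

theorem two_pow_sub_one_le {s : ℕ} (hs : 3 ≤ s) (e : ℕ) :
    (2 : ℝ) ^ (e + 2) - 1 ≤ 3 * s ^ e := by
  have hs' : (3 : ℝ) ≤ s := by exact_mod_cast hs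
  induction e with
  | zero => norm_num
  | succ e ih =>
    have h1 : (1 : ℝ) ≤ (s : ℝ) ^ e := one_le_pow₀ (by linarith)
    have h2 : (3 : ℝ) * s ^ e ≤ s * s ^ e := by gcongr
    rw [pow_succ (s : ℝ), pow_succ (2 : ℝ)]
    nlinarith

theorem exists_fin_three_ne (a b : Fin 3) : ∃ i, i ≠ a ∧ i ≠ b := by
  revert a b
  decide

theorem numColorings_lt_of_critical {s : ℕ} (hs : 3 ≤ s) {V : Type} [Finite V]
    {G : SimpleGraph V} (h3 : ¬ G.Colorable 3) {v : V}
    (hc : (G.induce ({v}ᶜ : Set V)).Connected) (hH : (G.induce ({v}ᶜ : Set V)).Colorable 3)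
    (hd : 3 ≤ (G.neighborSet v).ncard) (hn : (G.neighborSet v).ncard + 2 ≤ Nat.card V)
    (ih : ∀ (W : Type) [Finite W] (F : SimpleGraph W), Nat.card W < Nat.card V → F.Connected →
      ¬ F.Colorable 3 →
      (numColorings F (s + 1) : ℝ) ≤ (s + 1) * s ^ (Nat.card W - 3) * (s - 1) * (s - 2))
    (hP : (numColorings (G.induce ({v}ᶜ : Set V)) (s + 1) : ℝ) ≤
      s ^ Nat.card ({v}ᶜ : Set V) * ((1 - 1 / s ^ 2) * (1 - 3 / s ^ 2))) :
    (numColorings G (s + 1) : ℝ) < (s + 1) * s ^ (Nat.card V - 3) * (s - 1) * (s - 2) := by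
  have hs' : (3 : ℝ) ≤ s := by exact_mod_cast hs
  have hs1 : (0 : ℝ) < s - 1 := by linarith
  have hs2 : (0 : ℝ) < s - 2 := by linarith
  obtain ⟨S, hS, hSc⟩ := exists_finset_neighbors G v
  obtain ⟨c⟩ := hH
  obtain ⟨e, he⟩ := Nat.exists_eq_add_of_le' hd
  obtain ⟨r, hr⟩ := Nat.exists_eq_add_of_le' hn
  have hcard := card_compl_singleton_add_one v
  have hK : ∀ (W : Type) [Finite W] (F : SimpleGraph W), Nat.card W + S.card ≤ Nat.card V + 1 →
      F.Connected → ∀ φ : (G.induce ({v}ᶜ : Set V)) →g F,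
      (∃ p t, ∀ x ∈ S, φ x = p ∨ φ x = t) →
      (numColorings F (s + 1) : ℝ) ≤ (s + 1) * s ^ r * (s - 1) * (s - 2) := by
    intro W _ F hW hF φ hφ
    have hF3 : ¬ F.Colorable 3 := by
      rintro ⟨d⟩
      obtain ⟨p, t, hpt⟩ := hφ
      obtain ⟨i, hi1, hi2⟩ := exists_fin_three_ne (d p) (d t)
      refine h3 (colorable_of_missing_color (d.comp φ) i fun x hx => ?_)
      rcases hpt x ((hS x).2 hx) with h | h
      · exact fun h' => hi1 (h'.symm.trans (congrArg d h))
      · exact fun h' => hi2 (h'.symm.trans (congrArg d h))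
    refine (ih W F (by omega) hF hF3).trans ?_
    gcongr
    · linarith
    · omega
  obtain ⟨-, hlt⟩ := numColorings_le_of_many_neighbors
    (K := (s + 1) * s ^ r * (s - 1) * (s - 2)) hc (fun x hx => (hS x).1 hx) (by omega)
    (by omega : 2 ≤ s) (by positivity) hK
  have hlt' := hlt ?_ (by positivity)
  · rw [hSc, he, show e + 3 - 1 = e + 2 by omega] at hlt'
    have hV : Nat.card ({v}ᶜ : Set V) = r + e + 4 := by omega
    rw [hV] at hP
    calc _ < _ := hlt'
      _ ≤ (s - 2) * (s ^ (r + e + 4) * ((1 - 1 / s ^ 2) * (1 - 3 / s ^ 2))) +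
          (3 * s ^ e) * ((s + 1) * s ^ r * (s - 1) * (s - 2)) := by
        have := two_pow_sub_one_le hs e
        gcongr
      _ = (s + 1) * s ^ (r + e + 2) * (s - 1) * (s - 2) := by
        field_simp
        ring
      _ = _ := by
        rw [show Nat.card V - 3 = r + e + 2 by omega]
  · by_cases hedge : ∃ a ∈ S, ∃ b ∈ S, G.Adj a b
    · exact Or.inl hedge
    · right
      push Not at hedge
      classical
      refine Nat.card_pos_iff.2 ⟨⟨⟨fun x => if x ∈ S then ⟨3, by omega⟩ else
        (c x).castLE (by omega), fun x y hxy => ?_⟩, fun x hx y hy => by simp [hx, hy]⟩,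
        inferInstance⟩
      have h3' : ∀ (z : Fin 3), (z : ℕ) ≠ 3 := fun z => z.2.ne
      by_cases hx : x ∈ S <;> by_cases hy : y ∈ S
      · exact absurd hxy (hedge x hx y hy)
      · simp [hx, hy, Fin.ext_iff, (h3' _).symm]
      · simp [hx, hy, Fin.ext_iff, h3']
      · simpa [hx, hy, Fin.ext_iff] using c.valid hxy

/-- A set containing `v` whose other vertices have all their neighbours in the set is connected. -/
theorem induce_connected_of_boundary {V : Type} {G : SimpleGraph V} (hG : G.Connected) {v : V}
    {S : Set V} (hv : v ∈ S) (h : ∀ a ∈ S, a ≠ v → ∀ b, G.Adj a b → b ∈ S) :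
    (G.induce S).Connected := by
  rw [SimpleGraph.connected_iff_exists_forall_reachable]
  refine ⟨⟨v, hv⟩, ?_⟩
  rintro ⟨z, hz⟩
  refine SimpleGraph.Reachable.symm ?_
  obtain ⟨p⟩ := hG.preconnected z v
  induction p with
  | nil => exact SimpleGraph.Reachable.refl _
  | cons hadj p ih =>
    rename_i a b d
    by_cases hav : a = d
    · subst hav
      exact SimpleGraph.Reachable.refl _
    · have hb := h a hz hav b hadj
      exact (SimpleGraph.Adj.reachable (by exact hadj)).trans (ih hv h hb)

/-- If a connected graph is not `3`-colourable but all its proper connected parts are, then it has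
no cut vertex. -/
theorem connected_compl_of_critical {V : Type} {G : SimpleGraph V} (hG : G.Connected)
    (h3 : ¬ G.Colorable 3)
    (hcrit : ∀ S : Set V, S ≠ Set.univ → (G.induce S).Connected → (G.induce S).Colorable 3)
    (v : V) : (G.induce ({v}ᶜ : Set V)).Connected := by
  classical
  by_contra hnc
  have hne : Nonempty ({v}ᶜ : Set V) := by
    by_contra hemp
    rw [not_nonempty_iff] at hemp
    refine h3 ⟨SimpleGraph.Coloring.mk (fun _ => 0) fun {a b} hab => ?_⟩
    have h1 : a = v := by
      by_contra h
      exact hemp.elim ⟨a, h⟩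
    have h2 : b = v := by
      by_contra h
      exact hemp.elim ⟨b, h⟩
    exact absurd (h1.trans h2.symm) hab.ne
  have hxy : ∃ x y, ¬ (G.induce ({v}ᶜ : Set V)).Reachable x y := by
    by_contra hall
    push Not at hall
    exact hnc ⟨hall⟩
  obtain ⟨x, y, hxy⟩ := hxy
  let X : Set V := {z | ∃ hz : z ∈ ({v}ᶜ : Set V), (G.induce ({v}ᶜ : Set V)).Reachable x ⟨z, hz⟩}
  have hX : ∀ a ∈ X, ∀ b, G.Adj a b → b ≠ v → b ∈ X := by
    rintro a ⟨ha, har⟩ b hab hbv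
    exact ⟨hbv, har.trans (SimpleGraph.Adj.reachable (by exact hab))⟩
  have hvX : v ∉ X := fun ⟨h, _⟩ => h rfl
  have hxX : (x : V) ∈ X := ⟨x.2, SimpleGraph.Reachable.refl _⟩
  have hyX : (y : V) ∉ X := fun ⟨_, h⟩ => hxy h
  obtain ⟨c⟩ := hcrit Xᶜ (fun h => by
      have : (x : V) ∈ Xᶜ := h ▸ Set.mem_univ _
      exact this hxX)
    (induce_connected_of_boundary hG (v := v) hvX fun a ha hav b hab hb =>
      ha (hX b hb a hab.symm hav))
  obtain ⟨d⟩ := hcrit (insert v X) (fun h => by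
      have : (y : V) ∈ insert v X := h ▸ Set.mem_univ _
      exact this.elim (fun h => y.2 h) hyX)
    (induce_connected_of_boundary hG (v := v) (Set.mem_insert _ _) fun a ha hav b hab => by
      by_cases hb : b = v
      · exact Or.inl hb
      · exact Or.inr (hX a (ha.resolve_left hav) b hab hb))
  let π := Equiv.swap (d ⟨v, Set.mem_insert _ _⟩) (c ⟨v, hvX⟩)
  have hcross : ∀ a (ha : a ∈ X) b (hb : b ∉ X), G.Adj a b →
      π (d ⟨a, Set.mem_insert_of_mem _ ha⟩) ≠ c ⟨b, hb⟩ := by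
    intro a ha b hb hab
    have hbv : b = v := by
      by_contra h
      exact hb (hX a ha b hab h)
    subst hbv
    rw [← Equiv.swap_apply_left (d ⟨b, Set.mem_insert _ _⟩) (c ⟨b, hvX⟩)]
    exact fun h => (d.valid (by exact hab) :
      d ⟨a, Set.mem_insert_of_mem _ ha⟩ ≠ d ⟨b, Set.mem_insert _ _⟩) (π.injective h)
  refine h3 ⟨SimpleGraph.Coloring.mk (fun z => if hz : z ∈ X then
    π (d ⟨z, Set.mem_insert_of_mem _ hz⟩) else c ⟨z, hz⟩) fun {a b} hab => ?_⟩
  by_cases ha : a ∈ X <;> by_cases hb : b ∈ X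
  · simp only [ha, hb, dite_true]
    exact fun h => d.valid (by exact hab) (π.injective h)
  · simp only [ha, hb, dite_true, dite_false]
    exact hcross a ha b hb hab
  · simp only [ha, hb, dite_true, dite_false]
    exact (hcross b hb a ha hab.symm).symm
  · simp only [ha, hb, dite_false]
    exact c.valid (by exact hab)

theorem three_le_ncard_neighborSet {V : Type} [Finite V] {G : SimpleGraph V}
    (h3 : ¬ G.Colorable 3) {v : V} (hH : (G.induce ({v}ᶜ : Set V)).Colorable 3) :
    3 ≤ (G.neighborSet v).ncard := by
  classical
  obtain ⟨c⟩ := hH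
  obtain ⟨S, hS, hSc⟩ := exists_finset_neighbors G v
  by_contra hlt
  have h1 : (S.image c).card < 3 := Finset.card_image_le.trans_lt (by omega)
  obtain ⟨i, hi⟩ : ∃ i, i ∉ S.image c := by
    by_contra hall
    push Not at hall
    rw [Finset.eq_univ_iff_forall.2 hall] at h1
    simp at h1
  exact h3 (colorable_of_missing_color c i fun x hx h =>
    hi (Finset.mem_image.2 ⟨x, (hS x).2 hx, h⟩))

theorem not_colorable_two_compl {V : Type} {G : SimpleGraph V} (h3 : ¬ G.Colorable 3) (v : V) :
    ¬ (G.induce ({v}ᶜ : Set V)).Colorable 2 := by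
  rintro ⟨c⟩
  refine h3 (colorable_of_missing_color (w := v) (SimpleGraph.Coloring.mk
    (fun x => (c x).castSucc) fun {x y} hxy h => c.valid hxy (Fin.castSucc_injective _ h))
    (Fin.last 2) fun x _ => ?_)
  exact (Fin.castSucc_lt_last (c x)).ne

/-- Colouring an independent set with a third colour. -/
theorem colorable_three_of_independent {V : Type} {G : SimpleGraph V} (I : Set V)
    (hI : ∀ a ∈ I, ∀ b ∈ I, ¬ G.Adj a b) (h : (G.induce Iᶜ).Colorable 2) : G.Colorable 3 := by
  classical
  obtain ⟨c⟩ := h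
  refine ⟨SimpleGraph.Coloring.mk (fun x => if hx : x ∈ I then Fin.last 2 else
    (c ⟨x, hx⟩).castSucc) fun {a b} hab => ?_⟩
  by_cases ha : a ∈ I <;> by_cases hb : b ∈ I
  · exact absurd hab (hI a ha b hb)
  · simp only [ha, hb, dite_true, dite_false]
    exact (Fin.castSucc_lt_last _).ne'
  · simp only [ha, hb, dite_true, dite_false]
    exact (Fin.castSucc_lt_last _).ne
  · simp only [ha, hb, dite_false]
    exact fun h => c.valid (by exact hab) (Fin.castSucc_injective _ h)

end Critical

section Critical

theorem ncard_neighborSet_add_card_le {V : Type} [Finite V] {G : SimpleGraph V} {v : V}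
    (T : Finset V) (hT : ∀ y ∈ T, ¬ G.Adj v y) :
    (G.neighborSet v).ncard + T.card ≤ Nat.card V := by
  have hdisj : Disjoint (G.neighborSet v) (T : Set V) :=
    Set.disjoint_left.2 fun y hy hy' => hT y hy' hy
  rw [← Set.ncard_coe_finset, ← Set.ncard_univ, ← Set.ncard_union_eq hdisj]
  exact Set.ncard_le_ncard (Set.subset_univ _)

theorem ncard_neighborSet_lt {V : Type} [Finite V] (G : SimpleGraph V) (v : V) :
    (G.neighborSet v).ncard + 1 ≤ Nat.card V := by
  simpa using ncard_neighborSet_add_card_le (G := G) (v := v) {v} (by simp)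

theorem adj_of_card_le {V : Type} [Finite V] {G : SimpleGraph V} {v : V}
    (h : Nat.card V ≤ (G.neighborSet v).ncard + 1) {x : V} (hx : x ≠ v) : G.Adj v x := by
  classical
  by_contra hvx
  have h1 := ncard_neighborSet_add_card_le (G := G) (v := v) {v, x} (by simp [hvx])
  rw [Finset.card_pair hx.symm] at h1
  omega

/-- An independent set whose complement has at most four vertices and no triangle yields a
`3`-colouring. -/
theorem exists_triangle_of_independent {V : Type} [Finite V] {G : SimpleGraph V}
    (h3 : ¬ G.Colorable 3) (I : Set V) (hI : ∀ a ∈ I, ∀ b ∈ I, ¬ G.Adj a b)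
    (hc : Nat.card V ≤ I.ncard + 4) :
    ∃ a b c, a ∉ I ∧ b ∉ I ∧ c ∉ I ∧ G.Adj a b ∧ G.Adj b c ∧ G.Adj c a := by
  by_contra hT
  push Not at hT
  have h2 : ¬ (G.induce Iᶜ).Colorable 2 := fun h => h3 (colorable_three_of_independent I hI h)
  have h5 := five_le_card_of_not_colorable_two h2 fun a b c hab hbc =>
    hT a b c a.2 b.2 c.2 hab hbc
  rw [Nat.card_coe_set_eq] at h5
  have := Set.ncard_add_ncard_compl I
  omega

theorem pair_independent {V : Type} {G : SimpleGraph V} {v x : V} (h : ¬ G.Adj v x) :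
    ∀ a ∈ ({v, x} : Set V), ∀ b ∈ ({v, x} : Set V), ¬ G.Adj a b := by
  rintro a (rfl | rfl) b (rfl | rfl)
  · exact G.loopless.irrefl _
  · exact h
  · exact fun h' => h h'.symm
  · exact G.loopless.irrefl _

/-- If the neighbourhood of `v` together with at most four further vertices covers a graph that
is not `3`-colourable, then the graph has a triangle. -/
theorem hasTriangle_of_card_le {V : Type} [Finite V] {G : SimpleGraph V}
    (h3 : ¬ G.Colorable 3) {v : V} (hc : Nat.card V ≤ (G.neighborSet v).ncard + 5) :
    HasTriangle G := by
  by_contra hT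
  have hT' : ∀ a b c, G.Adj a b → G.Adj b c → ¬ G.Adj a c := fun a b c h1 h2 h3 =>
    hT ⟨a, b, c, h1, h2, h3⟩
  have hI : ∀ a ∈ G.neighborSet v, ∀ b ∈ G.neighborSet v, ¬ G.Adj a b := fun a ha b hb hab =>
    hT' v a b ha hab hb
  have h2 : ¬ (G.induce (G.neighborSet v)ᶜ).Colorable 2 := fun h =>
    h3 (colorable_three_of_independent _ hI h)
  have hR : ¬ ((G.induce (G.neighborSet v)ᶜ).induce
      ({⟨v, G.loopless.irrefl v⟩}ᶜ : Set ((G.neighborSet v)ᶜ : Set V))).Colorable 2 := by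
    rintro ⟨c⟩
    refine h2 (colorable_of_missing_color c 0 fun x hx => ?_)
    exact absurd hx x.1.2
  have h5 := five_le_card_of_not_colorable_two hR fun a b c hab hbc hca =>
    hT' _ _ _ hab hbc hca.symm
  have h6 := card_compl_singleton_add_one
    (⟨v, G.loopless.irrefl v⟩ : ((G.neighborSet v)ᶜ : Set V))
  rw [Nat.card_coe_set_eq (G.neighborSet v)ᶜ] at h6
  have h7 := Set.ncard_add_ncard_compl (G.neighborSet v)
  omega

theorem exists_degree_three_of_hasTriangle {V : Type} [Finite V] {G : SimpleGraph V}
    (hn : 6 ≤ Nat.card V) (hE : G.edgeSet.ncard ≤ Nat.card V + 4)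
    (hd : ∀ v, 3 ≤ (G.neighborSet v).ncard) (hT : HasTriangle G) :
    ∃ v, (G.neighborSet v).ncard = 3 ∧ HasTriangle (G.induce ({v}ᶜ : Set V)) := by
  classical
  have := Fintype.ofFinite V
  obtain ⟨a, b, c, hab, hbc, hac⟩ := hT
  by_contra hall
  push Not at hall
  have h4 : ∀ v, 4 ≤ (G.neighborSet v).ncard + if v ∈ ({a, b, c} : Finset V) then 1 else 0 := by
    intro v
    have h3 := hd v
    split_ifs with hv
    · omega
    · by_contra hlt
      simp only [Finset.mem_insert, Finset.mem_singleton, not_or] at hv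
      exact hall v (by omega) ⟨⟨a, Ne.symm hv.1⟩, ⟨b, Ne.symm hv.2.1⟩, ⟨c, Ne.symm hv.2.2⟩,
        hab, hbc, hac⟩
  have hsum := Finset.sum_le_sum fun v (_ : v ∈ Finset.univ) => h4 v
  rw [Finset.sum_add_distrib, sum_ncard_neighborSet, Finset.sum_const, Finset.card_univ,
    ← Nat.card_eq_fintype_card, Finset.sum_boole, Finset.filter_mem_eq_inter,
    Finset.univ_inter, smul_eq_mul] at hsum
  have h3 : ({a, b, c} : Finset V).card ≤ 3 := Finset.card_le_three
  simp only [Nat.cast_id] at hsum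
  omega

/-- In a graph with at most six vertices, minimum degree at least three and at most nine edges,
any triangle avoiding two non-adjacent vertices lies in a `K₄`. -/
theorem exists_adj_of_triangle {V : Type} [Finite V] {G : SimpleGraph V}
    (hn : Nat.card V ≤ 6) (hE : G.edgeSet.ncard ≤ 9)
    (hd : ∀ v, 3 ≤ (G.neighborSet v).ncard) {v x a b c : V} (hxv : x ≠ v) (hvx : ¬ G.Adj v x)
    (hav : a ≠ v) (hbv : b ≠ v) (hcv : c ≠ v) (hax : a ≠ x) (hbx : b ≠ x) (hcx : c ≠ x)
    (hab : G.Adj a b) (hbc : G.Adj b c) (hca : G.Adj c a) :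
    G.Adj v a ∧ G.Adj v b ∧ G.Adj v c := by
  classical
  have := Fintype.ofFinite V
  have hmiss : ∀ {y z p q : V}, y ≠ z → ¬ G.Adj y z → p ≠ y → p ≠ z → q ≠ y → q ≠ z → p ≠ q →
      ¬ G.Adj y p → G.Adj y q := by
    intro y z p q hyz hadj hpy hpz hqy hqz hpq hyp
    by_contra hyq
    have h1 := ncard_neighborSet_add_card_le (G := G) (v := y) {y, z, p, q}
      (by simp [hadj, hyp, hyq])
    rw [Finset.card_insert_of_notMem (by simp [hyz, hpy.symm, hqy.symm]),
      Finset.card_insert_of_notMem (by simp [hpz.symm, hqz.symm]), Finset.card_pair hpq] at h1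
    have := hd y
    omega
  have hmiss5 : ∀ {p : V}, p ≠ v → p ≠ x → Nat.card V ≤ 5 → G.Adj v p := by
    intro p hpv hpx h5
    by_contra hvp
    have h1 := ncard_neighborSet_add_card_le (G := G) (v := v) {v, x, p} (by simp [hvx, hvp])
    rw [Finset.card_insert_of_notMem (by simp [hxv.symm, hpv.symm]),
      Finset.card_pair hpx.symm] at h1
    have := hd v
    omega
  by_cases h5 : Nat.card V ≤ 5
  · exact ⟨hmiss5 hav hax h5, hmiss5 hbv hbx h5, hmiss5 hcv hcx h5⟩
  exfalso
  have hfour : ∀ {p q r : V}, p ≠ v → q ≠ v → r ≠ v → q ≠ x → r ≠ x → G.Adj p q → G.Adj p r →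
      q ≠ r → G.Adj v p → ¬ G.Adj x p := by
    intro p q r hpv hqv hrv hqx hrx hpq hpr hqr hvp hxp
    have h1 : 4 ≤ (G.neighborSet p).ncard := by
      have h0 : ({v, x, q, r} : Finset V).card = 4 := by
        rw [Finset.card_insert_of_notMem (by simp [hxv.symm, hqv.symm, hrv.symm]),
          Finset.card_insert_of_notMem (by simp [hqx.symm, hrx.symm]), Finset.card_pair hqr]
      rw [← h0, ← Set.ncard_coe_finset]
      refine Set.ncard_le_ncard ?_
      intro y hy
      simp only [Finset.coe_insert, Finset.coe_singleton] at hy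
      rcases hy with rfl | rfl | rfl | rfl
      · exact hvp.symm
      · exact hxp.symm
      · exact hpq
      · exact hpr
    have h2 := sum_ncard_neighborSet G
    rw [← Finset.add_sum_erase _ _ (Finset.mem_univ p)] at h2
    have h3 := Finset.card_nsmul_le_sum (Finset.univ.erase p) (fun y => (G.neighborSet y).ncard) 3
      fun y _ => hd y
    rw [Finset.card_erase_of_mem (Finset.mem_univ p), Finset.card_univ,
      ← Nat.card_eq_fintype_card, smul_eq_mul] at h3
    omega
  have hxv' : ¬ G.Adj x v := fun h => hvx h.symm
  have ha := hfour hav hbv hcv hbx hcx hab hca.symm hbc.ne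
  have hb := hfour hbv hcv hav hcx hax hbc hab.symm hca.ne
  have hc := hfour hcv hav hbv hax hbx hca hbc.symm hab.ne
  have v1 := hmiss hxv.symm hvx hav hax hbv hbx hab.ne
  have v2 := hmiss hxv.symm hvx hbv hbx hcv hcx hbc.ne
  have v3 := hmiss hxv.symm hvx hcv hcx hav hax hca.ne
  have x1 := hmiss hxv hxv' hax hav hbx hbv hab.ne
  have x2 := hmiss hxv hxv' hbx hbv hcx hcv hbc.ne
  have x3 := hmiss hxv hxv' hcx hcv hax hav hca.ne
  tauto

/-- A non-complete vertex-critical graph exceeds the extremal number of colourings strictly. -/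
theorem numColorings_lt_of_forall_compl {s : ℕ} (hs : 3 ≤ s) {V : Type} [Finite V]
    {G : SimpleGraph V} (h3 : ¬ G.Colorable 3)
    (hc : ∀ v, (G.induce ({v}ᶜ : Set V)).Connected)
    (hH : ∀ v, (G.induce ({v}ᶜ : Set V)).Colorable 3)
    (hK : ∀ a b c d, G.Adj a b → G.Adj a c → G.Adj a d → G.Adj b c → G.Adj b d → ¬ G.Adj c d)
    (ih : ∀ (W : Type) [Finite W] (F : SimpleGraph W), Nat.card W < Nat.card V → F.Connected →
      ¬ F.Colorable 3 →
      (numColorings F (s + 1) : ℝ) ≤ (s + 1) * s ^ (Nat.card W - 3) * (s - 1) * (s - 2)) :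
    (numColorings G (s + 1) : ℝ) < (s + 1) * s ^ (Nat.card V - 3) * (s - 1) * (s - 2) := by
  classical
  have := Fintype.ofFinite V
  have hd : ∀ v, 3 ≤ (G.neighborSet v).ncard := fun v => three_le_ncard_neighborSet h3 (hH v)
  have hV : Nonempty V := by
    by_contra hemp
    rw [not_nonempty_iff] at hemp
    exact h3 ⟨SimpleGraph.Coloring.mk (fun _ => 0) fun {a b} _ => hemp.elim a⟩
  obtain ⟨v, hv⟩ := Finite.exists_min fun v => (G.neighborSet v).ncard
  have hsum : Nat.card V * (G.neighborSet v).ncard ≤ 2 * G.edgeSet.ncard := by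
    rw [← sum_ncard_neighborSet, Nat.card_eq_fintype_card, ← Finset.card_univ, ← smul_eq_mul,
      ← Finset.sum_const]
    exact Finset.sum_le_sum fun x _ => hv x
  have hdv := hd v
  have hlt := ncard_neighborSet_lt G v
  have hcard := card_compl_singleton_add_one v
  have hedge := ncard_edgeSet_compl_singleton G v
  have hn : (G.neighborSet v).ncard + 2 ≤ Nat.card V := by
    by_contra hn
    have hadj : ∀ x y, x ≠ y → G.Adj x y := fun x y hxy =>
      adj_of_card_le (by have := hv x; omega) hxy.symm
    obtain ⟨a, b, c, d, h⟩ : ∃ a b c d : V, a ≠ b ∧ a ≠ c ∧ a ≠ d ∧ b ≠ c ∧ b ≠ d ∧ c ≠ d := by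
      have e := Fintype.equivFin V
      rw [Nat.card_eq_fintype_card] at hlt
      refine ⟨e.symm ⟨0, by omega⟩, e.symm ⟨1, by omega⟩, e.symm ⟨2, by omega⟩,
        e.symm ⟨3, by omega⟩, ?_⟩
      simp [e.symm.injective.eq_iff]
    exact hK a b c d (hadj _ _ h.1) (hadj _ _ h.2.1) (hadj _ _ h.2.2.1) (hadj _ _ h.2.2.2.1)
      (hadj _ _ h.2.2.2.2.1) (hadj _ _ h.2.2.2.2.2)
  by_cases hE : Nat.card V + (G.neighborSet v).ncard + 2 ≤ G.edgeSet.ncard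
  · exact numColorings_lt_of_critical hs h3 (hc v) (hH v) hdv hn ih
      (numColorings_le_of_three_extra_edges hs (hc v) (not_colorable_two_compl h3 v) (by omega))
  have hd3 : (G.neighborSet v).ncard = 3 := by
    by_contra hne
    obtain ⟨d, hd⟩ := Nat.exists_eq_add_of_le' (show 4 ≤ (G.neighborSet v).ncard by omega)
    obtain ⟨n, hn'⟩ := Nat.exists_eq_add_of_le' (show 6 ≤ Nat.card V by omega)
    rw [hd, hn'] at hsum hE
    nlinarith
  rw [hd3] at hsum hE hn
  have hn8 : Nat.card V ≤ 8 := by omega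
  obtain ⟨x, hxv, hx⟩ : ∃ x, x ≠ v ∧ ¬ G.Adj v x := by
    by_contra hall
    push Not at hall
    have h1 := Set.ncard_compl_add_ncard ({v} : Set V)
    rw [Set.ncard_singleton] at h1
    have h2 := Set.ncard_le_ncard (s := ({v}ᶜ : Set V)) (t := G.neighborSet v)
      fun x hx => hall x hx
    omega
  by_cases h6 : Nat.card V ≤ 6 ∧ G.edgeSet.ncard ≤ 9
  · exfalso
    obtain ⟨a, b, c, ha, hb, hc, hab, hbc, hca⟩ := exists_triangle_of_independent h3 {v, x}
      (pair_independent hx) (by rw [Set.ncard_pair hxv.symm]; omega)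
    simp only [Set.mem_insert_iff, Set.mem_singleton_iff, not_or] at ha hb hc
    obtain ⟨h1, h2, h3⟩ := exists_adj_of_triangle h6.1 h6.2 hd hxv hx ha.1 hb.1 hc.1 ha.2 hb.2 hc.2
      hab hbc hca
    exact hK v a b c h1 h2 h3 hab hca.symm hbc
  · obtain ⟨w, hw, hT⟩ := exists_degree_three_of_hasTriangle (by omega) (by omega) hd
      (hasTriangle_of_card_le h3 (v := v) (by omega))
    have hcardw := card_compl_singleton_add_one w
    have hedgew := ncard_edgeSet_compl_singleton G w
    exact numColorings_lt_of_critical hs h3 (hc w) (hH w) hw.ge (by omega) ih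
      (numColorings_le_of_hasTriangle_of_two_extra_edges hs (hc w) hT (by omega))

end Critical

section Pendants

/-- The graph on `Fin n` in which the first `k` vertices form a clique and every later vertex `i` is
joined to the earlier vertex `p i`. -/
abbrev pendantGraph (k n : ℕ) (p : ℕ → ℕ) : SimpleGraph (Fin n) :=
  SimpleGraph.fromRel (fun a b : Fin n =>
    (a.val < k ∧ b.val < k ∧ a ≠ b) ∨ (k ≤ a.val ∧ p a.val = b.val))

theorem pendantGraph_self (k : ℕ) (p : ℕ → ℕ) : pendantGraph k k p = ⊤ := by
  ext a b
  have ha := a.2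
  have hb := b.2
  simp only [SimpleGraph.fromRel_adj, SimpleGraph.top_adj]
  tauto

theorem pendantGraph_adj_castSucc {k n : ℕ} {p r : ℕ → ℕ} (hpr : ∀ i < n, p i = r i) (a b : Fin n) :
    (pendantGraph k (n + 1) p).Adj a.castSucc b.castSucc ↔ (pendantGraph k n r).Adj a b := by
  simp [SimpleGraph.fromRel_adj, hpr a a.2, hpr b b.2]

theorem pendantGraph_adj_last {k n : ℕ} {p : ℕ → ℕ} (hk : k ≤ n)
    (hp : ∀ i, k ≤ i → i < n + 1 → p i < i) (y : Fin (n + 1)) :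
    (pendantGraph k (n + 1) p).Adj (Fin.last n) y ↔ (y : ℕ) = p n := by
  have hpn := hp n hk (by omega)
  have hy := y.2
  simp only [SimpleGraph.fromRel_adj, Fin.val_last, Fin.ext_iff, ne_eq]
  constructor
  · rintro ⟨h1, (h | h) | (h | h)⟩
    · omega
    · exact h.2.symm
    · omega
    · have := hp y h.1 hy
      omega
  · intro h
    exact ⟨by omega, Or.inl (Or.inr ⟨hk, h.symm⟩)⟩

/-- Removing the last vertex of `pendantGraph k (n + 1) p` leaves `pendantGraph k n p`. -/
noncomputable def pendantGraphIso (k n : ℕ) (p : ℕ → ℕ) : pendantGraph k n p ≃g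
    (pendantGraph k (n + 1) p).induce ({Fin.last n}ᶜ : Set (Fin (n + 1))) where
  toEquiv := Equiv.ofBijective (fun i => ⟨i.castSucc, (Fin.castSucc_lt_last i).ne⟩)
    ⟨fun _ _ h => Fin.castSucc_injective n (congrArg Subtype.val h), fun ⟨y, hy⟩ =>
      ⟨y.castPred hy, Subtype.ext (Fin.castSucc_castPred y hy)⟩⟩
  map_rel_iff' := pendantGraph_adj_castSucc (fun _ _ => rfl) _ _

theorem numColorings_top_fin (k q : ℕ) :
    numColorings (⊤ : SimpleGraph (Fin k)) q = q.descFactorial k := by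
  have h : Nat.card (Fin k ↪ Fin q) = q.descFactorial k := by
    rw [Nat.card_eq_fintype_card, Fintype.card_embedding_eq, Fintype.card_fin, Fintype.card_fin]
  rw [← h]
  refine Nat.card_congr ⟨fun f => ⟨f.1, ?_⟩,
    fun f => ⟨f, fun u v h h' => h (f.injective h')⟩, fun _ => rfl, fun _ => rfl⟩
  intro a b h
  by_contra hab
  exact f.2 a b hab h

theorem numColorings_pendantGraph {n : ℕ} (hn : 4 ≤ n) {p : ℕ → ℕ}
    (hp : ∀ i, 4 ≤ i → i < n → p i < i) (q : ℕ) :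
    numColorings (pendantGraph 4 n p) q = q * (q - 1) ^ (n - 3) * (q - 2) * (q - 3) := by
  induction n, hn using Nat.le_induction with
  | base =>
    rw [pendantGraph_self, numColorings_top_fin]
    simp [Nat.descFactorial]
    ring
  | succ n hn ih =>
    have hpn := hp n hn (by omega)
    rw [numColorings_of_unique_adj (w := Fin.last n) (x := ⟨p n, by omega⟩) (fun y => by
      rw [pendantGraph_adj_last hn hp, Fin.ext_iff]), ← numColorings_congr (pendantGraphIso 4 n p),
      ih fun i hi hin => hp i hi (by omega), show n + 1 - 3 = n - 3 + 1 by omega, pow_succ]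
    ring

theorem ObtainedFromCliqueByPendants.numColorings_eq {V : Type} {G : SimpleGraph V}
    (h : ObtainedFromCliqueByPendants G 4) :
    4 ≤ Nat.card V ∧ ∀ q, numColorings G q =
      q * (q - 1) ^ (Nat.card V - 3) * (q - 2) * (q - 3) := by
  obtain ⟨n, p, hn, hp, ⟨e⟩⟩ := h
  have hV : Nat.card V = n := by rw [Nat.card_congr e.toEquiv, Nat.card_fin]
  rw [hV]
  exact ⟨hn, fun q => by rw [numColorings_congr e, numColorings_pendantGraph hn hp]⟩

theorem ObtainedFromCliqueByPendants.of_forall_adj {V : Type} [Finite V] {G : SimpleGraph V}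
    (h : ∀ x y, x ≠ y → G.Adj x y) : ObtainedFromCliqueByPendants G (Nat.card V) := by
  refine ⟨Nat.card V, id, le_rfl, fun i h1 h2 => by omega, ?_⟩
  rw [show G = ⊤ from eq_top_iff.2 fun x y hxy => h x y hxy]
  change Nonempty (⊤ ≃g pendantGraph _ _ _)
  rw [pendantGraph_self]
  exact ⟨SimpleGraph.Iso.completeGraph (Finite.equivFin V)⟩

theorem ObtainedFromCliqueByPendants.of_compl {V : Type} {G : SimpleGraph V} {k : ℕ} {w x : V}
    (hx : ∀ y, G.Adj w y ↔ y = x)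
    (h : ObtainedFromCliqueByPendants (G.induce ({w}ᶜ : Set V)) k) :
    ObtainedFromCliqueByPendants G k := by
  classical
  obtain ⟨n, p, hn, hp, ⟨e⟩⟩ := h
  have hxw : x ∈ ({w}ᶜ : Set V) := ((hx x).2 rfl).ne'
  let r := Function.update p n (e ⟨x, hxw⟩)
  have hrn : r n = e ⟨x, hxw⟩ := Function.update_self ..
  have hr : ∀ i < n, r i = p i := fun i hi => Function.update_of_ne hi.ne ..
  have hr' : ∀ i, k ≤ i → i < n + 1 → r i < i := by
    intro i hi hin
    rcases Nat.lt_succ_iff_lt_or_eq.1 hin with h | rfl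
    · rw [hr i h]
      exact hp i hi h
    · rw [hrn]
      exact (e ⟨x, hxw⟩).2
  let f : V → Fin (n + 1) := fun z => if hz : z ∈ ({w}ᶜ : Set V) then (e ⟨z, hz⟩).castSucc else
    Fin.last n
  have hfw : f w = Fin.last n := dif_neg fun h => h rfl
  have hf : ∀ z (hz : z ∈ ({w}ᶜ : Set V)), f z = (e ⟨z, hz⟩).castSucc := fun z hz => dif_pos hz
  have hlast : ∀ y, (pendantGraph k (n + 1) r).Adj (f w) (f y) ↔ G.Adj w y := by
    intro y
    rw [hfw, pendantGraph_adj_last hn hr', hrn, hx]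
    by_cases hy : y = w
    · subst hy
      rw [hfw]
      have h1 := (e ⟨x, hxw⟩).2
      exact ⟨fun h => absurd h (by simpa using h1.ne'), fun h => absurd h.symm hxw⟩
    · rw [hf y hy, Fin.val_castSucc, ← Fin.ext_iff, e.injective.eq_iff]
      exact ⟨congrArg Subtype.val, fun h => Subtype.ext h⟩
  have hbij : Function.Bijective f := by
    constructor
    · intro a b hab
      by_cases ha : a = w <;> by_cases hb : b = w
      · rw [ha, hb]
      · rw [ha, hfw, hf b hb] at hab
        exact absurd hab (Fin.castSucc_lt_last _).ne'
      · rw [hb, hfw, hf a ha] at hab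
        exact absurd hab (Fin.castSucc_lt_last _).ne
      · rw [hf a ha, hf b hb] at hab
        exact congrArg Subtype.val (e.injective (Fin.castSucc_injective _ hab))
    · intro y
      rcases Fin.eq_castSucc_or_eq_last y with ⟨z, rfl⟩ | rfl
      · exact ⟨(e.symm z : V), by rw [hf _ (e.symm z).2]; simp⟩
      · exact ⟨w, hfw⟩
  refine ⟨n + 1, r, by omega, hr', ⟨⟨Equiv.ofBijective f hbij, fun {a b} => ?_⟩⟩⟩
  change (pendantGraph k (n + 1) r).Adj (f a) (f b) ↔ _
  by_cases ha : a = w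
  · rw [ha, hlast]
  by_cases hb : b = w
  · rw [hb, SimpleGraph.adj_comm, hlast, SimpleGraph.adj_comm]
  · rw [hf a ha, hf b hb, pendantGraph_adj_castSucc hr, e.map_adj_iff]
    rfl

end Pendants

section Extremal

theorem ObtainedFromCliqueByPendants.cast_numColorings_eq {V : Type} {G : SimpleGraph V}
    (h : ObtainedFromCliqueByPendants G 4) {s : ℕ} (hs : 2 ≤ s) :
    (numColorings G (s + 1) : ℝ) = (s + 1) * s ^ (Nat.card V - 3) * (s - 1) * (s - 2) := by
  obtain ⟨t, rfl⟩ := Nat.exists_eq_add_of_le' hs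
  rw [h.numColorings_eq.2, show t + 2 + 1 - 1 = t + 2 by omega,
    show t + 2 + 1 - 2 = t + 1 by omega, show t + 2 + 1 - 3 = t by omega]
  push_cast
  ring

theorem four_le_card_of_not_colorable_three {V : Type} [Finite V] {G : SimpleGraph V}
    (h3 : ¬ G.Colorable 3) : 4 ≤ Nat.card V := by
  have := Fintype.ofFinite V
  by_contra hlt
  rw [Nat.card_eq_fintype_card] at hlt
  exact h3 (G.colorable_of_fintype.mono (by omega))

theorem not_colorable_three_of_clique {V : Type} {G : SimpleGraph V} {a b c d : V}
    (hab : G.Adj a b) (hac : G.Adj a c) (had : G.Adj a d) (hbc : G.Adj b c) (hbd : G.Adj b d)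
    (hcd : G.Adj c d) : ¬ G.Colorable 3 := by
  rintro ⟨f⟩
  have h : ∀ p q r t : Fin 3, ¬ (p ≠ q ∧ p ≠ r ∧ p ≠ t ∧ q ≠ r ∧ q ≠ t ∧ r ≠ t) := by decide
  exact h _ _ _ _ ⟨f.valid hab, f.valid hac, f.valid had, f.valid hbc, f.valid hbd, f.valid hcd⟩

theorem obtained_of_clique_of_critical {V : Type} [Finite V] {G : SimpleGraph V}
    (hG : G.Connected) (hcol : ∀ w, (G.induce ({w}ᶜ : Set V)).Connected →
      (G.induce ({w}ᶜ : Set V)).Colorable 3) {a b c d : V}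
    (hab : G.Adj a b) (hac : G.Adj a c) (had : G.Adj a d) (hbc : G.Adj b c) (hbd : G.Adj b d)
    (hcd : G.Adj c d) : ObtainedFromCliqueByPendants G 4 := by
  classical
  have hS : (G.induce ({a, b, c, d} : Set V)).Connected := by
    rw [SimpleGraph.connected_iff_exists_forall_reachable]
    refine ⟨⟨a, by simp⟩, ?_⟩
    rintro ⟨x, rfl | rfl | rfl | rfl⟩
    · exact SimpleGraph.Reachable.refl _
    · exact SimpleGraph.Adj.reachable (by exact hab)
    · exact SimpleGraph.Adj.reachable (by exact hac)
    · exact SimpleGraph.Adj.reachable (by exact had)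
  have huniv : ({a, b, c, d} : Set V) = Set.univ := by
    by_contra hne
    obtain ⟨w, hw, hc⟩ := exists_notMem_connected_compl hG ⟨a, by simp⟩ hne hS
    simp only [Set.mem_insert_iff, Set.mem_singleton_iff, not_or] at hw
    obtain ⟨h1, h2, h3, h4⟩ := hw
    exact not_colorable_three_of_clique (G := G.induce ({w}ᶜ : Set V)) (a := ⟨a, Ne.symm h1⟩)
      (b := ⟨b, Ne.symm h2⟩) (c := ⟨c, Ne.symm h3⟩) (d := ⟨d, Ne.symm h4⟩)
      hab hac had hbc hbd hcd (hcol w hc)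
  have hcard : Nat.card V = 4 := by
    rw [← Set.ncard_univ, ← huniv]
    have h0 : ({a, b, c, d} : Finset V).card = 4 := by
      rw [Finset.card_insert_of_notMem (by simp [hab.ne, hac.ne, had.ne]),
        Finset.card_insert_of_notMem (by simp [hbc.ne, hbd.ne]), Finset.card_pair hcd.ne]
    rw [← h0, ← Set.ncard_coe_finset]
    simp
  have h := ObtainedFromCliqueByPendants.of_forall_adj (G := G) fun x y hxy => by
    have hx : x ∈ ({a, b, c, d} : Set V) := huniv ▸ Set.mem_univ x
    have hy : y ∈ ({a, b, c, d} : Set V) := huniv ▸ Set.mem_univ y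
    rcases hx with rfl | rfl | rfl | rfl <;> rcases hy with rfl | rfl | rfl | rfl <;>
      first | exact absurd rfl hxy | assumption | (apply SimpleGraph.Adj.symm; assumption)
  rwa [hcard] at h

/-- The number of colourings of a connected graph that is not `3`-colourable is at most that of
`K₄` with pendant vertices added, with equality only for such graphs. -/
theorem numColorings_le_of_not_colorable_three {s : ℕ} (hs : 3 ≤ s) (n : ℕ) :
    ∀ (V : Type) [Finite V] (G : SimpleGraph V), Nat.card V = n → G.Connected →
      ¬ G.Colorable 3 →
      (numColorings G (s + 1) : ℝ) ≤ (s + 1) * s ^ (Nat.card V - 3) * (s - 1) * (s - 2) ∧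
      ((numColorings G (s + 1) : ℝ) = (s + 1) * s ^ (Nat.card V - 3) * (s - 1) * (s - 2) →
        ObtainedFromCliqueByPendants G 4) := by
  have hs' : (3 : ℝ) ≤ s := by exact_mod_cast hs
  have hs1 : (0 : ℝ) < s - 1 := by linarith
  have hs2 : (0 : ℝ) < s - 2 := by linarith
  induction n using Nat.strong_induction_on with
  | _ n ih =>
  intro V _ G hV hG h3
  subst hV
  by_cases hw : ∃ w, (G.induce ({w}ᶜ : Set V)).Connected ∧
      ¬ (G.induce ({w}ᶜ : Set V)).Colorable 3
  · obtain ⟨w, hc, hw3⟩ := hw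
    have hcard := card_compl_singleton_add_one w
    have h4 := four_le_card_of_not_colorable_three hw3
    obtain ⟨hle, heq⟩ := ih _ (by omega) _ (G.induce ({w}ᶜ : Set V)) rfl hc hw3
    obtain ⟨r, hr⟩ := Nat.exists_eq_add_of_le' h4
    rw [hr, show r + 4 - 3 = r + 1 by omega] at hle heq
    rw [show Nat.card V - 3 = r + 2 by omega]
    set K : ℝ := (s + 1) * s ^ r * (s - 1) * (s - 2) with hK
    have hK0 : 0 < K := by positivity
    have e1 : ((s : ℝ) + 1) * s ^ (r + 1) * (s - 1) * (s - 2) = s * K := by rw [hK]; ring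
    have e2 : ((s : ℝ) + 1) * s ^ (r + 2) * (s - 1) * (s - 2) = s * (s * K) := by rw [hK]; ring
    rw [e1] at hle heq
    rw [e2]
    obtain ⟨x, hx⟩ := exists_adj_of_connected_compl hG hc
    by_cases hy : ∃ y, G.Adj w y ∧ y ≠ x
    · obtain ⟨y, hy, hyx⟩ := hy
      have h := numColorings_le_of_two_neighbors hc hx hy hyx.symm (by omega : 1 ≤ s) hK0.le
        fun W _ F hW hF φ _ => by
          have hF3 : ¬ F.Colorable 3 := fun ⟨c⟩ => hw3 ⟨c.comp φ⟩
          have hF4 := four_le_card_of_not_colorable_three hF3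
          refine (ih _ (by omega) W F rfl hF hF3).1.trans ?_
          rw [hK]
          gcongr
          · linarith
          · omega
      have hlt : (numColorings G (s + 1) : ℝ) < s * (s * K) := by nlinarith
      exact ⟨hlt.le, fun h => absurd h hlt.ne⟩
    · push Not at hy
      have huniq : ∀ y, G.Adj w y ↔ y = x := fun y => ⟨hy y, fun h => h ▸ hx⟩
      have h : (numColorings G (s + 1) : ℝ) =
          s * numColorings (G.induce ({w}ᶜ : Set V)) (s + 1) := by
        rw [numColorings_of_unique_adj huniq]
        push_cast
        simp
      rw [h]
      exact ⟨by gcongr, fun h' => (heq (mul_left_cancel₀ (by positivity) h')).of_compl huniq⟩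
  · push Not at hw
    by_cases hK : ∃ a b c d, G.Adj a b ∧ G.Adj a c ∧ G.Adj a d ∧ G.Adj b c ∧ G.Adj b d ∧ G.Adj c d
    · obtain ⟨a, b, c, d, h1, h2, h3, h4, h5, h6⟩ := hK
      have h := obtained_of_clique_of_critical hG hw h1 h2 h3 h4 h5 h6
      exact ⟨(h.cast_numColorings_eq (by omega)).le, fun _ => h⟩
    · push Not at hK
      have hcrit : ∀ S : Set V, S ≠ Set.univ → (G.induce S).Connected →
          (G.induce S).Colorable 3 := by
        intro S hS hc
        obtain ⟨x⟩ := hc.nonempty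
        obtain ⟨w, hwS, hwc⟩ := exists_notMem_connected_compl hG ⟨x, x.2⟩ hS hc
        obtain ⟨f⟩ := hw w hwc
        exact ⟨f.comp (SimpleGraph.induceHomOfLE G (fun y hy (h : y = w) => hwS (h ▸ hy))).toHom⟩
      have hconn := connected_compl_of_critical hG h3 hcrit
      have hlt := numColorings_lt_of_forall_compl hs h3 hconn (fun v => hw v (hconn v)) hK
        fun W _ F hW hF hF3 => (ih _ hW W F rfl hF hF3).1
      exact ⟨hlt.le, fun h => absurd h hlt.ne⟩

theorem ObtainedFromCliqueByPendants.eval_eq {V : Type} {G : SimpleGraph V}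
    (h : ObtainedFromCliqueByPendants G 4) {P : Polynomial ℝ}
    (hP : ∀ x : ℕ, P.eval (x : ℝ) = numColorings G x) (y : ℝ) :
    P.eval (y + 1) = (y + 1) * y ^ (Nat.card V - 3) * (y - 1) * (y - 2) := by
  let R : Polynomial ℝ := (.X + 1) * .X ^ (Nat.card V - 3) * (.X - 1) * (.X - 2)
  have hR : P.comp (.X + 1) = R := by
    refine Polynomial.eq_of_infinite_eval_eq _ _ ((Set.infinite_range_of_injective
      (f := fun s : ℕ => ((s + 2 : ℕ) : ℝ)) fun a b hab => ?_).mono ?_)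
    · simpa using hab
    · rintro _ ⟨s, rfl⟩
      have h1 := h.cast_numColorings_eq (show 2 ≤ s + 2 by omega)
      rw [← hP] at h1
      simpa [R] using h1
  have h2 := congrArg (Polynomial.eval y) hR
  simpa [R] using h2

end Extremal

/-- Equality case for `k = 4`: if a connected graph `G` on `n` vertices with chromatic number
exactly `4` satisfies `Q_G(y) = (y+1)·y^(n-3)·(y-1)·(y-2)` for some integer `y ≥ 3`, then `G`
is obtained from `K_4` by repeatedly adding pendant vertices; conversely, every graph obtained
from `K_4` in this way satisfies `Q_G(y) = (y+1)·y^(n-3)·(y-1)·(y-2)` for every real `y`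
(where `Q_G` is the shifted chromatic polynomial, i.e. the polynomial interpolating the
counting function `x ↦ P_G(x)` evaluated at `y + 1`). -/
theorem tomescu_four_chromatic_equality {V : Type} [Fintype V] (G : SimpleGraph V) :
    (G.Connected → G.chromaticNumber = 4 →
      (∃ y : ℕ, 3 ≤ y ∧
        numColorings G (y + 1) =
          (y + 1) * y ^ (Fintype.card V - 3) * (y - 1) * (y - 2)) →
      ObtainedFromCliqueByPendants G 4) ∧
    (ObtainedFromCliqueByPendants G 4 →
      ∀ P : Polynomial ℝ, (∀ x : ℕ, P.eval (x : ℝ) = numColorings G x) →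
        ∀ y : ℝ, P.eval (y + 1) =
          (y + 1) * y ^ (Fintype.card V - 3) * (y - 1) * (y - 2)) := by
  constructor
  · rintro hG hχ ⟨y, hy, hQ⟩
    have h3 : ¬ G.Colorable 3 := by
      intro h
      have h4 := SimpleGraph.chromaticNumber_le_iff_colorable.2 h
      rw [hχ] at h4
      exact absurd h4 (by decide)
    refine (numColorings_le_of_not_colorable_three hy _ V G rfl hG h3).2 ?_
    rw [hQ, Nat.card_eq_fintype_card]
    push_cast [show 1 ≤ y by omega, show 2 ≤ y by omega]
    ring
  · intro h P hP y
    rw [h.eval_eq hP, Nat.card_eq_fintype_card]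
end

section
/- Let k ≥ 1, let x ≥ k be an integer, and let G be a connected graph on n vertices containing a clique of order k. Then G has at most x(x-1)(x-2)···(x-k+1)·(x-1)^{n-k} proper x-colourings, i.e., P_G(x) ≤ x^{\underline{k}}·(x-1)^{n-k}. -/
/-- A clique on `s` has at most as many colourings as there are injections from `s`. -/
theorem numColorings_induce_le_descFactorial {V : Type} (G : SimpleGraph V) (x : ℕ)
    (s : Finset V) (hs : G.IsClique s) :
    numColorings (G.induce {v | v ∈ s}) x ≤ Nat.descFactorial x s.card := by
  classical
  have hcard : Nat.card ({v | v ∈ s} ↪ Fin x) = Nat.descFactorial x s.card := by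
    rw [Nat.card_eq_fintype_card, Fintype.card_embedding_eq]
    simp
  rw [← hcard]
  refine Nat.card_le_card_of_injective
    (fun f => ⟨f.1, fun a b hab => by_contra fun hne =>
      f.2 a b (hs a.2 b.2 fun h => hne (Subtype.ext h)) hab⟩) ?_
  intro f g hfg
  exact Subtype.ext (congrArg (fun e : {v | v ∈ s} ↪ Fin x => (e : _ → Fin x)) hfg)

/-- Adding a vertex adjacent to an old one multiplies the number of colourings by at most
`x - 1`. -/
theorem numColorings_induce_insert_le {V : Type} [DecidableEq V] (G : SimpleGraph V) (x : ℕ)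
    (t : Finset V) {u w : V} (hu : u ∈ t) (huw : G.Adj u w) :
    numColorings (G.induce {v | v ∈ insert w t}) x ≤
      numColorings (G.induce {v | v ∈ t}) x * (x - 1) := by
  classical
  let C := {f : {v | v ∈ t} → Fin x // ∀ a b, (G.induce {v | v ∈ t}).Adj a b → f a ≠ f b}
  have hcard : Nat.card (Σ f : C, {c : Fin x // c ≠ f.1 ⟨u, hu⟩}) =
      numColorings (G.induce {v | v ∈ t}) x * (x - 1) := by
    rw [Nat.card_sigma]
    simp [numColorings, C, Fintype.card_subtype_compl]
  rw [← hcard]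
  refine Nat.card_le_card_of_injective
    (fun f => ⟨⟨fun a => f.1 ⟨a.1, Finset.mem_insert_of_mem a.2⟩,
      fun a b hab => f.2 _ _ hab⟩, ⟨f.1 ⟨w, Finset.mem_insert_self w t⟩,
      f.2 _ _ huw.symm⟩⟩) ?_
  intro f g hfg
  have hold := congrArg (fun p : (Σ f : C, {c : Fin x // c ≠ f.1 ⟨u, hu⟩}) => p.1.1) hfg
  have hnew := congrArg (fun p : (Σ f : C, {c : Fin x // c ≠ f.1 ⟨u, hu⟩}) => p.2.1) hfg
  refine Subtype.ext (funext fun ⟨a, ha⟩ => ?_)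
  rcases Finset.mem_insert.1 ha with rfl | hat
  · exact hnew
  · exact congrFun hold ⟨a, hat⟩

/-- A connected graph has an edge leaving any nonempty proper vertex set. -/
theorem SimpleGraph.Connected.exists_adj_mem_notMem {V : Type} {G : SimpleGraph V}
    (hconn : G.Connected) {t : Set V} (hne : t.Nonempty) (hcompl : tᶜ.Nonempty) :
    ∃ u ∈ t, ∃ w ∉ t, G.Adj u w := by
  obtain ⟨a, ha⟩ := hne
  obtain ⟨b, hb⟩ := hcompl
  obtain ⟨p⟩ := hconn.preconnected a b
  obtain ⟨d, -, h1, h2⟩ := p.exists_boundary_dart t ha hb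
  exact ⟨d.fst, h1, d.snd, h2, d.adj⟩

/-- A nonempty clique grows, one vertex at a time, to vertex sets of every larger size whose
induced subgraphs have few colourings. -/
theorem exists_card_eq_numColorings_induce_le {V : Type} [Fintype V] (G : SimpleGraph V)
    (hconn : G.Connected) (x : ℕ) (s : Finset V) (hne : s.Nonempty) (hs : G.IsClique s)
    (m : ℕ) (hm : s.card + m ≤ Fintype.card V) :
    ∃ t : Finset V, t.card = s.card + m ∧
      numColorings (G.induce {v | v ∈ t}) x ≤ Nat.descFactorial x s.card * (x - 1) ^ m := by
  classical
  induction m with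
  | zero => exact ⟨s, rfl, by simpa using numColorings_induce_le_descFactorial G x s hs⟩
  | succ m ih =>
    obtain ⟨t, htcard, ht⟩ := ih (by omega)
    have htne : t.Nonempty := Finset.card_pos.1 (by have := hne.card_pos; omega)
    obtain ⟨b, hb⟩ : ∃ b, b ∉ t := by
      by_contra! h
      have := Finset.card_univ (α := V)
      rw [← Finset.eq_univ_iff_forall.2 h] at this
      omega
    obtain ⟨u, hu, w, hw, huw⟩ := hconn.exists_adj_mem_notMem (t := {v | v ∈ t}) htne ⟨b, hb⟩
    refine ⟨insert w t, by rw [Finset.card_insert_of_notMem hw, htcard]; rfl, ?_⟩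
    calc numColorings (G.induce {v | v ∈ insert w t}) x
        ≤ numColorings (G.induce {v | v ∈ t}) x * (x - 1) :=
          numColorings_induce_insert_le G x t hu huw
      _ ≤ Nat.descFactorial x s.card * (x - 1) ^ m * (x - 1) := Nat.mul_le_mul_right _ ht
      _ = Nat.descFactorial x s.card * (x - 1) ^ (m + 1) := by rw [pow_succ, mul_assoc]

/-- Let `k ≥ 1`, let `x ≥ k` be an integer, and let `G` be a connected graph on `n` vertices
containing a clique of order `k`. Then `G` has at most `x·(x-1)···(x-k+1)·(x-1)^(n-k)`
proper `x`-colourings. -/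
theorem numColorings_le_of_clique {V : Type} [Fintype V] (G : SimpleGraph V)
    (hconn : G.Connected) (k x : ℕ) (hk : 1 ≤ k) (hx : k ≤ x)
    (s : Finset V) (hs : G.IsNClique k s) :
    numColorings G x ≤ Nat.descFactorial x k * (x - 1) ^ (Fintype.card V - k) := by
  obtain ⟨hclique, rfl⟩ := hs
  have hle := s.card_le_univ
  obtain ⟨t, htcard, ht⟩ := exists_card_eq_numColorings_induce_le G hconn x s
    (Finset.card_pos.1 hk) hclique (Fintype.card V - s.card) (by omega)
  have hmem : ∀ v, v ∈ t :=
    Finset.eq_univ_iff_forall.1 ((Finset.card_eq_iff_eq_univ t).1 (by omega))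
  refine le_trans (Nat.card_le_card_of_injective
    (fun f => ⟨fun a => f.1 a.1, fun a b hab => f.2 _ _ hab⟩) ?_) ht
  intro f g hfg
  have hval := congrArg Subtype.val hfg
  exact Subtype.ext (funext fun a => congrFun hval ⟨a, hmem a⟩)
end

section
/- Let G be a graph, let v ∈ V(G) be a vertex of degree d ≥ 2, let G' = G − v, and let y be a positive integer. Let B be a function of y and suppose that for every ℓ ≥ 1, every graph H on |V(G')| − ℓ vertices that can be formed from G' by repeatedly identifying pairs of nonadjacent vertices satisfies Q_H(y) ≤ y^{-ℓ}·B(y). Fix r with 1 ≤ r ≤ d−1 and let N_r be the number of partitions of the neighbourhood N(v) into exactly r non-empty independent sets. Then Q_G(y) ≤ (y − r)·Q_{G'}(y) + N_r·y^{-d+r}·B(y). -/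
/-- `H` is formed from `G` by repeatedly identifying pairs of nonadjacent vertices, the
identifications being recorded by the surjection `f`: vertices with the same image are
pairwise nonadjacent in `G`, and two vertices of `H` are adjacent exactly when some pair of
their preimages is adjacent in `G`. -/
def IsIdentification {V W : Type} (G : SimpleGraph V) (H : SimpleGraph W) (f : V → W) : Prop :=
  Function.Surjective f ∧ (∀ a b : V, f a = f b → ¬ G.Adj a b) ∧
    (∀ w₁ w₂ : W, H.Adj w₁ w₂ ↔ ∃ a b : V, f a = w₁ ∧ f b = w₂ ∧ G.Adj a b)

/-- `P` is a partition of the finite set `N` into exactly `r` non-empty parts. -/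
def IsPartitionInto {V : Type} [DecidableEq V] (N : Finset V) (r : ℕ)
    (P : Finset (Finset V)) : Prop :=
  P.card = r ∧ P.sup id = N ∧ (∀ p ∈ P, p.Nonempty) ∧
    (P : Set (Finset V)).PairwiseDisjoint id

/-- The partition of `N` into the fibres of `h`. -/
def fiberPartition {V α : Type} [DecidableEq V] [DecidableEq α] (N : Finset V) (h : V → α) :
    Finset (Finset V) :=
  (N.image h).image fun a => N.filter fun u => h u = a

section Partitions

variable {V α : Type} [DecidableEq V] [DecidableEq α]

theorem mem_fiberPartition {N : Finset V} {h : V → α} {p : Finset V} :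
    p ∈ fiberPartition N h ↔ ∃ u ∈ N, (N.filter fun w => h w = h u) = p := by
  simp [fiberPartition]

theorem isPartitionInto_fiberPartition (N : Finset V) (h : V → α) :
    IsPartitionInto N (N.image h).card (fiberPartition N h) := by
  refine ⟨?_, ?_, ?_, ?_⟩
  · refine Finset.card_image_of_injOn ?_
    intro a ha b hb hab
    obtain ⟨u, hu, rfl⟩ := Finset.mem_image.1 ha
    have hmem : u ∈ N.filter fun w => h w = b := by
      rw [← show (N.filter fun w => h w = h u) = N.filter fun w => h w = b from hab]
      simp [hu]
    exact (Finset.mem_filter.1 hmem).2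
  · ext u
    simp only [Finset.mem_sup, mem_fiberPartition, id]
    constructor
    · rintro ⟨p, ⟨w, hw, rfl⟩, hu⟩
      exact (Finset.mem_filter.1 hu).1
    · intro hu
      exact ⟨_, ⟨u, hu, rfl⟩, by simp [hu]⟩
  · intro p hp
    obtain ⟨u, hu, rfl⟩ := mem_fiberPartition.1 hp
    exact ⟨u, by simp [hu]⟩
  · intro p hp q hq hpq
    obtain ⟨u, hu, rfl⟩ := mem_fiberPartition.1 (Finset.mem_coe.1 hp)
    obtain ⟨w, hw, rfl⟩ := mem_fiberPartition.1 (Finset.mem_coe.1 hq)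
    refine Finset.disjoint_left.2 fun a ha hb => hpq ?_
    rw [id, Finset.mem_filter] at ha hb
    rw [← ha.2, ← hb.2]

theorem apply_eq_of_fiberPartition_eq {β : Type} [DecidableEq β] {N : Finset V} {h : V → α}
    {g : V → β} (hP : fiberPartition N h = fiberPartition N g) {a b : V} (ha : a ∈ N) (hb : b ∈ N)
    (hab : g a = g b) : h a = h b := by
  have hmem : (N.filter fun w => g w = g a) ∈ fiberPartition N h := by
    rw [hP]; exact mem_fiberPartition.2 ⟨a, ha, rfl⟩
  obtain ⟨u, -, hu⟩ := mem_fiberPartition.1 hmem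
  have h₁ : a ∈ N.filter fun w => h w = h u := by rw [hu]; simp [ha]
  have h₂ : b ∈ N.filter fun w => h w = h u := by rw [hu]; simp [hb, hab]
  rw [(Finset.mem_filter.1 h₁).2, (Finset.mem_filter.1 h₂).2]

/-- A partition into at most `r < |N|` classes has sufficiently many refinements with exactly
`r` parts. -/
theorem le_card_refinements [Fintype V] (N : Finset V) (c : V → α) (r : ℕ)
    (hc : (N.image c).card ≤ r) (hr : r < N.card) :
    r + 1 - (N.image c).card ≤
      {P : Finset (Finset V) | IsPartitionInto N r P ∧
        ∀ p ∈ P, ∀ a ∈ p, ∀ b ∈ p, c a = c b}.ncard := by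
  obtain ⟨t, ht⟩ : ∃ t : α → V, ∀ u ∈ N, t (c u) ∈ N ∧ c (t (c u)) = c u := by
    classical
    refine ⟨fun a => if h : ∃ u ∈ N, c u = a then h.choose else
      (Finset.card_pos.1 (by omega : 0 < N.card)).choose, fun u hu => ?_⟩
    have h : ∃ w ∈ N, c w = c u := ⟨u, hu, rfl⟩
    simp only [dif_pos h]
    exact h.choose_spec
  set T : Finset V := N.image fun u => t (c u) with hT
  have htT : ∀ u ∈ N, t (c u) ∈ T := fun u hu => Finset.mem_image_of_mem _ hu
  have hTN : T ⊆ N := by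
    intro w hw
    obtain ⟨u, hu, rfl⟩ := Finset.mem_image.1 hw
    exact (ht u hu).1
  have htfix : ∀ w ∈ T, t (c w) = w := by
    intro w hw
    obtain ⟨u, hu, rfl⟩ := Finset.mem_image.1 hw
    simp only [(ht u hu).2]
  have hTcard : T.card = (N.image c).card := by
    have : T = (N.image c).image t := by rw [hT, Finset.image_image]; rfl
    rw [this]
    refine Finset.card_image_of_injOn fun a ha b hb hab => ?_
    obtain ⟨u, hu, rfl⟩ := Finset.mem_image.1 ha
    obtain ⟨w, hw, rfl⟩ := Finset.mem_image.1 hb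
    rw [← (ht u hu).2, ← (ht w hw).2, hab]
  let h : Finset V → V → V := fun S u => if u ∈ S then u else t (c u)
  have hch : ∀ S, ∀ u ∈ N, c (h S u) = c u := by
    intro S u hu
    by_cases hS : u ∈ S
    · simp [h, hS]
    · simp [h, hS, (ht u hu).2]
  let F : Finset (Finset V) := (N \ T).powersetCard (r - (N.image c).card)
  have hFmem : ∀ S ∈ F, S ⊆ N \ T ∧ S.card = r - (N.image c).card := fun S hS =>
    Finset.mem_powersetCard.1 hS
  have himage : ∀ S ∈ F, N.image (h S) = S ∪ T := by
    intro S hS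
    have hSN := (hFmem S hS).1
    ext w
    simp only [Finset.mem_image, Finset.mem_union]
    constructor
    · rintro ⟨u, hu, rfl⟩
      by_cases hS' : u ∈ S
      · simp [h, hS']
      · simp [h, hS', htT u hu]
    · rintro (hw | hw)
      · exact ⟨w, (Finset.mem_sdiff.1 (hSN hw)).1, by simp [h, hw]⟩
      · have hw' : w ∉ S := fun hwS => (Finset.mem_sdiff.1 (hSN hwS)).2 hw
        exact ⟨w, hTN hw, by simp [h, hw', htfix w hw]⟩
  have hcard : ∀ S ∈ F, (N.image (h S)).card = r := by
    intro S hS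
    have hdisj : Disjoint S T := (Finset.subset_sdiff.1 (hFmem S hS).1).2
    rw [himage S hS, Finset.card_union_of_disjoint hdisj, (hFmem S hS).2, hTcard]
    omega
  have hsub : ∀ S ∈ F, ∀ S' ∈ F, fiberPartition N (h S) = fiberPartition N (h S') → S ⊆ S' := by
    intro S hS S' hS' hP s hs
    by_contra hs'
    obtain ⟨hsN, hsT⟩ := Finset.mem_sdiff.1 ((hFmem S hS).1 hs)
    have hrep : t (c s) ∈ T := htT s hsN
    have hnot : ∀ S ∈ F, t (c s) ∉ S := fun S hS hmem =>
      (Finset.mem_sdiff.1 ((hFmem S hS).1 hmem)).2 hrep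
    have heq : h S' s = h S' (t (c s)) := by
      simp [h, hs', hnot S' hS', htfix _ hrep]
    have := apply_eq_of_fiberPartition_eq hP hsN (hTN hrep) heq
    simp only [h, if_pos hs, if_neg (hnot S hS), htfix _ hrep] at this
    exact hsT (this ▸ hrep)
  have hinj : Set.InjOn (fun S => fiberPartition N (h S)) (F : Set (Finset V)) :=
    fun S hS S' hS' hP => Finset.Subset.antisymm (hsub S hS S' hS' hP) (hsub S' hS' S hS hP.symm)
  have hFcard : r + 1 - (N.image c).card ≤ F.card := by
    rw [Finset.card_powersetCard, Finset.card_sdiff_of_subset hTN, hTcard]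
    calc r + 1 - (N.image c).card = (r - (N.image c).card + 1).choose (r - (N.image c).card) := by
          rw [Nat.choose_succ_self_right]; omega
      _ ≤ _ := Nat.choose_le_choose _ (by omega)
  refine hFcard.trans ?_
  rw [← Set.ncard_coe_finset]
  refine Set.ncard_le_ncard_of_injOn _ ?_ hinj (Set.toFinite _)
  intro S hS
  refine ⟨?_, ?_⟩
  · have := isPartitionInto_fiberPartition N (h S)
    rwa [hcard S hS] at this
  · intro p hp a ha b hb
    obtain ⟨u, -, rfl⟩ := mem_fiberPartition.1 hp
    rw [Finset.mem_filter] at ha hb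
    rw [← hch S a ha.1, ← hch S b hb.1, ha.2, hb.2]

end Partitions

/-- Colourings constant on the classes of an identification are colourings of the
identified graph. -/
theorem card_colorings_le_of_isIdentification {V W : Type} [Finite W]
    {G : SimpleGraph V} {H : SimpleGraph W} {f : V → W} (hf : IsIdentification G H f) (x : ℕ) :
    Nat.card {c : V → Fin x //
      (∀ u v : V, G.Adj u v → c u ≠ c v) ∧ ∀ a b, f a = f b → c a = c b} ≤ numColorings H x := by
  obtain ⟨hsurj, -, hadj⟩ := hf
  have hinv := Function.surjInv_eq hsurj
  refine Nat.card_le_card_of_injective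
    (fun c => ⟨fun w => c.1 (Function.surjInv hsurj w), ?_⟩) ?_
  · intro w₁ w₂ hw
    obtain ⟨a, b, rfl, rfl, hab⟩ := (hadj _ _).1 hw
    beta_reduce
    rw [c.2.2 _ a (hinv _), c.2.2 _ b (hinv _)]
    exact c.2.1 a b hab
  · intro c c' h
    ext u
    have := congrFun (congrArg Subtype.val h) (f u)
    simp only at this
    rw [c.2.2 _ u (hinv _), c'.2.2 _ u (hinv _)] at this
    rw [this]

/-- The graph obtained by identifying vertices along a map with independent fibres. -/
theorem exists_isIdentification {V W : Type} (G : SimpleGraph V) (f : V → W)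
    (hf : Function.Surjective f) (hind : ∀ a b, f a = f b → ¬ G.Adj a b) :
    ∃ H : SimpleGraph W, IsIdentification G H f :=
  ⟨{ Adj := fun w₁ w₂ => ∃ a b : V, f a = w₁ ∧ f b = w₂ ∧ G.Adj a b
     symm := ⟨fun _ _ ⟨a, b, ha, hb, h⟩ => ⟨b, a, hb, ha, h.symm⟩⟩
     loopless := ⟨fun _ ⟨a, b, ha, hb, h⟩ => hind a b (ha.trans hb.symm) h⟩ },
    hf, hind, fun _ _ => Iff.rfl⟩

/-- Extend a function defined away from `v` by the value `0` at `v`. -/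
def extendZero {V : Type} [DecidableEq V] {v : V} {n : ℕ} (c : {u : V | u ≠ v} → Fin (n + 1)) :
    V → Fin (n + 1) :=
  fun u => if h : u ≠ v then c ⟨u, h⟩ else 0

section DeleteVertex

variable {V : Type} [DecidableEq V] {v : V} {n : ℕ}

theorem extendZero_apply (c : {u : V | u ≠ v} → Fin (n + 1)) (u : {u : V | u ≠ v}) :
    extendZero c u = c u :=
  dif_pos u.2

variable [Fintype V] (G : SimpleGraph V) [DecidableRel G.Adj]

open Classical in
/-- A colouring of `G - v` using `k` colours on the neighbours of `v` has at most `n + 1 - k`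
extensions to an `(n + 1)`-colouring of `G`. -/
theorem numColorings_le_sum (v : V) (n : ℕ) :
    numColorings G (n + 1) ≤
      ∑ c : {c : {u : V | u ≠ v} → Fin (n + 1) //
        ∀ a b, (G.induce {u : V | u ≠ v}).Adj a b → c a ≠ c b},
        (n + 1 - ((G.neighborFinset v).image (extendZero c.1)).card) := by
  have hcard : ∀ s : Finset (Fin (n + 1)),
      n + 1 - s.card = Nat.card {x : Fin (n + 1) // x ∈ sᶜ} := by
    intro s
    simp
  simp_rw [hcard]
  rw [← Nat.card_sigma]
  refine Nat.card_le_card_of_injective (fun f =>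
    ⟨⟨fun u => f.1 u, fun a b hab => f.2 a b hab⟩, ⟨f.1 v, ?_⟩⟩) ?_
  · simp only [Finset.mem_compl, Finset.mem_image, SimpleGraph.mem_neighborFinset, not_exists,
      not_and]
    intro u hu h
    have hne : u ≠ v := hu.ne'
    rw [extendZero_apply (v := v) _ ⟨u, hne⟩] at h
    exact f.2 v u hu h.symm
  · intro f g h
    have h₁ := congrArg (fun z => z.1.1) h
    have h₂ := congrArg (fun z => z.2.1) h
    ext u
    by_cases hu : u = v
    · subst hu
      exact congrArg Fin.val h₂
    · exact congrArg Fin.val (congrFun h₁ ⟨u, hu⟩)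

/-- Identifying the parts of a partition of `N(v)` into `r` independent sets yields a graph on
`|V| - 1 - (d - r)` vertices, whose colourings include the colourings of `G - v` constant on
the parts. -/
theorem exists_isIdentification_of_isPartitionInto (v : V) (n : ℕ) {r : ℕ}
    {P : Finset (Finset V)} (hP : IsPartitionInto (G.neighborFinset v) r P)
    (hind : ∀ p ∈ P, ∀ a ∈ p, ∀ b ∈ p, ¬ G.Adj a b) (hr : r ≤ G.degree v) :
    ∃ (W : Type) (H : SimpleGraph W) (f : {u : V | u ≠ v} → W),
      Nat.card W = (Fintype.card V - 1) - (G.degree v - r) ∧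
      IsIdentification (G.induce {u : V | u ≠ v}) H f ∧
      Nat.card {c : {u : V | u ≠ v} → Fin (n + 1) //
        (∀ a b, (G.induce {u : V | u ≠ v}).Adj a b → c a ≠ c b) ∧
        ∀ p ∈ P, ∀ a ∈ p, ∀ b ∈ p, extendZero c a = extendZero c b} ≤
          numColorings H (n + 1) := by
  classical
  obtain ⟨hcard, hsup, hne, hdisj⟩ := hP
  have hsub : ∀ p ∈ P, p ⊆ G.neighborFinset v := fun p hp => hsup ▸ Finset.le_sup (f := id) hp
  set R : Finset V := (Finset.univ.erase v) \ G.neighborFinset v with hR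
  set Q : Finset (Finset V) := P ∪ R.image singleton with hQ
  have hQcard : Q.card = (Fintype.card V - 1) - (G.degree v - r) := by
    have hvN : G.neighborFinset v ⊆ Finset.univ.erase v := by
      intro u hu
      rw [SimpleGraph.mem_neighborFinset] at hu
      simp [hu.ne']
    have hle := Finset.card_le_card hvN
    rw [Finset.card_erase_of_mem (Finset.mem_univ v), Finset.card_univ,
      G.card_neighborFinset_eq_degree] at hle
    rw [hQ, Finset.card_union_of_disjoint, Finset.card_image_of_injective _
      Finset.singleton_injective, hR, Finset.card_sdiff_of_subset hvN,
      Finset.card_erase_of_mem (Finset.mem_univ v), Finset.card_univ,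
      G.card_neighborFinset_eq_degree, hcard]
    · omega
    · refine Finset.disjoint_left.2 fun p hp hp' => ?_
      obtain ⟨u, hu, rfl⟩ := Finset.mem_image.1 hp'
      exact (Finset.mem_sdiff.1 hu).2 (hsub _ hp (Finset.mem_singleton_self u))
  have hex : ∀ u : {u : V | u ≠ v}, ∃ q : {q // q ∈ Q}, u.1 ∈ q.1 := by
    intro u
    by_cases hu : u.1 ∈ G.neighborFinset v
    · rw [← hsup, Finset.mem_sup] at hu
      obtain ⟨p, hp, hup⟩ := hu
      exact ⟨⟨p, Finset.mem_union_left _ hp⟩, hup⟩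
    · refine ⟨⟨{u.1}, Finset.mem_union_right _ (Finset.mem_image_of_mem _ ?_)⟩,
        Finset.mem_singleton_self _⟩
      exact Finset.mem_sdiff.2 ⟨Finset.mem_erase.2 ⟨u.2, Finset.mem_univ _⟩, hu⟩
  have huniq : ∀ p ∈ Q, ∀ q ∈ Q, ∀ u, u ∈ p → u ∈ q → p = q := by
    intro p hp q hq u hup huq
    rcases Finset.mem_union.1 hp with hp | hp <;> rcases Finset.mem_union.1 hq with hq | hq
    · by_contra hpq
      exact Finset.disjoint_left.1 (hdisj hp hq hpq) hup huq
    · obtain ⟨w, hw, rfl⟩ := Finset.mem_image.1 hq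
      obtain rfl := Finset.mem_singleton.1 huq
      exact absurd (hsub p hp hup) (Finset.mem_sdiff.1 hw).2
    · obtain ⟨w, hw, rfl⟩ := Finset.mem_image.1 hp
      obtain rfl := Finset.mem_singleton.1 hup
      exact absurd (hsub q hq huq) (Finset.mem_sdiff.1 hw).2
    · obtain ⟨w, hw, rfl⟩ := Finset.mem_image.1 hp
      obtain ⟨w', hw', rfl⟩ := Finset.mem_image.1 hq
      rw [← Finset.mem_singleton.1 hup, ← Finset.mem_singleton.1 huq]
  choose f hf using hex
  have hsurj : Function.Surjective f := by
    rintro ⟨q, hq⟩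
    obtain ⟨u, huq, huv⟩ : ∃ u ∈ q, u ≠ v := by
      rcases Finset.mem_union.1 hq with hq | hq
      · obtain ⟨u, hu⟩ := hne q hq
        have := hsub q hq hu
        rw [SimpleGraph.mem_neighborFinset] at this
        exact ⟨u, hu, this.ne'⟩
      · obtain ⟨w, hw, rfl⟩ := Finset.mem_image.1 hq
        exact ⟨w, Finset.mem_singleton_self w,
          (Finset.mem_erase.1 (Finset.mem_sdiff.1 hw).1).1⟩
    exact ⟨⟨u, huv⟩, Subtype.ext (huniq _ (f ⟨u, huv⟩).2 q hq u (hf ⟨u, huv⟩) huq)⟩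
  have hclass : ∀ a b, f a = f b → a = b ∨ ∃ p ∈ P, a.1 ∈ p ∧ b.1 ∈ p := by
    intro a b hab
    have ha := hf a
    have hb := hf b
    rw [← hab] at hb
    rcases Finset.mem_union.1 (f a).2 with hp | hp
    · exact Or.inr ⟨_, hp, ha, hb⟩
    · obtain ⟨w, -, hw⟩ := Finset.mem_image.1 hp
      rw [← hw, Finset.mem_singleton] at ha hb
      exact Or.inl (Subtype.ext (ha.trans hb.symm))
  obtain ⟨H, hH⟩ := exists_isIdentification (G.induce {u : V | u ≠ v}) f hsurj (by
    intro a b hab hadj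
    rcases hclass a b hab with rfl | ⟨p, hp, ha, hb⟩
    · exact hadj.ne rfl
    · exact hind p hp _ ha _ hb hadj)
  refine ⟨{q // q ∈ Q}, H, f, by simp [hQcard], hH,
    le_trans ?_ (card_colorings_le_of_isIdentification hH (n + 1))⟩
  refine Nat.card_le_card_of_injective (fun c => ⟨c.1, c.2.1, fun a b hab => ?_⟩) ?_
  · rcases hclass a b hab with rfl | ⟨p, hp, ha, hb⟩
    · rfl
    · have := c.2.2 p hp _ ha _ hb
      rwa [extendZero_apply, extendZero_apply] at this
  · intro c c' h
    exact Subtype.ext (congrArg (fun z => z.1) h)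

end DeleteVertex

/-- Lemma on deleting a single vertex: let `v` have degree `d ≥ 2` in `G`, let `G' = G - v`,
and let `y` be a positive integer.  Suppose `B` is a function of `y` such that for every
`ℓ ≥ 1`, every graph `H` on `|G'| - ℓ` vertices formed from `G'` by repeatedly identifying
pairs of nonadjacent vertices satisfies `Q_H(y) ≤ y^{-ℓ}·B(y)`.  If `1 ≤ r ≤ d - 1` and
`N_r` is the number of partitions of `N(v)` into exactly `r` non-empty independent sets,
then `Q_G(y) ≤ (y - r)·Q_{G'}(y) + N_r·y^{-d+r}·B(y)`. -/
theorem single_vertex_bound {V : Type} [Fintype V] [DecidableEq V] (G : SimpleGraph V)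
    [DecidableRel G.Adj]
    (v : V) (d : ℕ) (hd : G.degree v = d) (hd2 : 2 ≤ d)
    (y : ℕ) (hy : 1 ≤ y) (B : ℕ → ℝ)
    (hB : ∀ ℓ : ℕ, 1 ≤ ℓ → ∀ (W : Type) (H : SimpleGraph W)
      (f : {u : V | u ≠ v} → W), Nat.card W = (Fintype.card V - 1) - ℓ →
      IsIdentification (G.induce {u : V | u ≠ v}) H f →
      (numColorings H (y + 1) : ℝ) ≤ (y : ℝ) ^ (-(ℓ : ℤ)) * B y)
    (r : ℕ) (hr1 : 1 ≤ r) (hrd : r ≤ d - 1)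
    (Nr : ℕ)
    (hNr : Nr = {P : Finset (Finset V) | P.card = r ∧
      P.sup id = G.neighborFinset v ∧ (∀ p ∈ P, p.Nonempty) ∧
      (P : Set (Finset V)).PairwiseDisjoint id ∧
      ∀ p ∈ P, ∀ a ∈ p, ∀ b ∈ p, ¬ G.Adj a b}.ncard) :
    (numColorings G (y + 1) : ℝ) ≤
      ((y : ℝ) - r) * numColorings (G.induce {u : V | u ≠ v}) (y + 1) +
        (Nr : ℝ) * (y : ℝ) ^ ((r : ℤ) - (d : ℤ)) * B y := by
  classical
  subst hd
  set N := G.neighborFinset v with hN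
  have hNcard : N.card = G.degree v := G.card_neighborFinset_eq_degree v
  let A := {c : {u : V | u ≠ v} → Fin (y + 1) //
    ∀ a b, (G.induce {u : V | u ≠ v}).Adj a b → c a ≠ c b}
  let k : A → ℕ := fun c => (N.image (extendZero c.1)).card
  let S : Finset (Finset (Finset V)) := Finset.univ.filter fun P =>
    IsPartitionInto N r P ∧ ∀ p ∈ P, ∀ a ∈ p, ∀ b ∈ p, ¬ G.Adj a b
  let mono : A → Finset (Finset V) → Prop := fun c P =>
    ∀ p ∈ P, ∀ a ∈ p, ∀ b ∈ p, extendZero c.1 a = extendZero c.1 b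
  have hNr' : Nr = S.card := by
    rw [hNr, ← Set.ncard_coe_finset]
    congr 1
    ext P
    simp [S, IsPartitionInto, and_assoc]
  have hQ : (numColorings (G.induce {u : V | u ≠ v}) (y + 1) : ℝ) = ∑ _c : A, (1 : ℝ) := by
    simp [numColorings, A, Nat.card_eq_fintype_card]
  have hrefine : ∀ c : A, r + 1 - k c ≤ (S.filter (mono c)).card := by
    intro c
    by_cases hk : k c ≤ r
    · refine (le_card_refinements N (extendZero c.1) r hk (by omega)).trans ?_
      rw [← Set.ncard_coe_finset]
      refine Set.ncard_le_ncard ?_ (Set.toFinite _)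
      rintro P ⟨hP, hmono⟩
      simp only [S, mono, Finset.coe_filter, Finset.mem_filter, Finset.mem_univ, true_and,
        Set.mem_ofPred_eq]
      refine ⟨⟨hP, fun p hp a ha b hb hab => ?_⟩, hmono⟩
      have hpN : ∀ u ∈ p, u ≠ v := by
        intro u hu
        have : u ∈ N := hP.2.1 ▸ Finset.mem_sup.2 ⟨p, hp, hu⟩
        rw [hN, SimpleGraph.mem_neighborFinset] at this
        exact this.ne'
      have hc := c.2 ⟨a, hpN a ha⟩ ⟨b, hpN b hb⟩ hab
      rw [← extendZero_apply c.1, ← extendZero_apply c.1] at hc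
      exact hc (hmono p hp a ha b hb)
    · omega
  have hpart : ∀ P ∈ S, ((Finset.univ.filter fun c : A => mono c P).card : ℝ) ≤
      (y : ℝ) ^ ((r : ℤ) - (G.degree v : ℤ)) * B y := by
    intro P hP
    obtain ⟨hP₁, hP₂⟩ := (Finset.mem_filter.1 hP).2
    obtain ⟨W, H, f, hW, hf, hle⟩ :=
      exists_isIdentification_of_isPartitionInto G v y hP₁ hP₂ (by omega)
    have hb := hB (G.degree v - r) (by omega) W H f hW hf
    rw [show -((G.degree v - r : ℕ) : ℤ) = (r : ℤ) - (G.degree v : ℤ) by omega] at hb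
    refine le_trans ?_ hb
    refine Nat.cast_le.2 (le_trans ?_ hle)
    rw [← Fintype.card_subtype, ← Nat.card_eq_fintype_card]
    exact Nat.card_le_card_of_injective (fun c => ⟨c.1.1, c.1.2, c.2⟩)
      fun c c' h => Subtype.ext (Subtype.ext (congrArg (fun z => z.1) h))
  have hcount : ∑ c : A, (S.filter (mono c)).card =
      ∑ P ∈ S, (Finset.univ.filter fun c : A => mono c P).card :=
    Finset.sum_card_bipartiteAbove_eq_sum_card_bipartiteBelow mono
  calc (numColorings G (y + 1) : ℝ)
      ≤ ∑ c : A, ((y + 1 - k c : ℕ) : ℝ) := by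
        exact_mod_cast numColorings_le_sum G v y
    _ ≤ ∑ c : A, (((y : ℝ) - r) + ((S.filter (mono c)).card : ℝ)) := by
        refine Finset.sum_le_sum fun c _ => ?_
        have hk : k c ≤ y + 1 := (Finset.card_le_univ _).trans (by simp)
        have h := hrefine c
        rw [Nat.cast_sub hk]
        have : ((r + 1 : ℕ) : ℝ) ≤ ((k c + (S.filter (mono c)).card : ℕ) : ℝ) := by
          exact_mod_cast (by omega)
        push_cast at this ⊢
        linarith
    _ = ((y : ℝ) - r) * numColorings (G.induce {u : V | u ≠ v}) (y + 1) +
          ∑ P ∈ S, ((Finset.univ.filter fun c : A => mono c P).card : ℝ) := by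
        rw [Finset.sum_add_distrib, hQ, Finset.mul_sum]
        congr 1
        · simp
        · exact_mod_cast hcount
    _ ≤ _ := by
        refine add_le_add le_rfl ((Finset.sum_le_sum hpart).trans_eq ?_)
        rw [Finset.sum_const, nsmul_eq_mul, hNr', mul_assoc]
end
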